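/- Let f be an area-preserving positive twist map of the closed annulus A = 𝕋 × [0,1] and f̃ a lift of f to Ã = ℝ × [0,1]. For every real number ρ ∈ [ρ_{f̃}(C₀), ρ_{f̃}(C₁)] there exists a nonempty well ordered f-invariant closed set X ⊆ A with ρ_{f̃}(X) = ρ, i.e. such that −1 < p̃₁(f̃ᵏ(z̃)) − p̃₁(z̃) − kρ < 1 for every z̃ ∈ π⁻¹(X) and every k ∈ ℤ. -/

import Mathlib

open Set Filter Topology MeasureTheory

noncomputable section

/-- The circle `𝕋 = ℝ/ℤ`. -/
abbrev 𝕋 : Type := AddCircle (1 : ℝ)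

/-- The closed annulus `A = 𝕋 × [0,1]`. -/
abbrev Ann : Type := 𝕋 × ↥(Set.Icc (0:ℝ) 1)

/-- The universal cover `Ã = ℝ × [0,1]`. -/
abbrev StripA : Type := ℝ × ↥(Set.Icc (0:ℝ) 1)

/-- The covering projection `π : Ã → A`. -/
def annProj : StripA → Ann := fun z => ((z.1 : 𝕋), z.2)

/-- The deck translation `T(x̃,y) = (x̃+1,y)`. -/
def deckT : StripA → StripA := fun z => (z.1 + 1, z.2)

/-- The iterated deck translation `T^p`, `p ∈ ℤ`. -/
def deckZ (p : ℤ) : StripA → StripA := fun z => (z.1 + (p : ℝ), z.2)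

/-- The boundary circle `C₀ = 𝕋 × {0}`. -/
def C0 : Set Ann := {z | (z.2 : ℝ) = 0}

/-- The boundary circle `C₁ = 𝕋 × {1}`. -/
def C1 : Set Ann := {z | (z.2 : ℝ) = 1}

/-- A point of `Ã` on the boundary line `ℝ × {0}`. -/
def bd0 (x : ℝ) : StripA := (x, ⟨0, by norm_num⟩)

/-- A point of `Ã` on the boundary line `ℝ × {1}`. -/
def bd1 (x : ℝ) : StripA := (x, ⟨1, by norm_num⟩)

/-- A homeomorphism of the closed annulus isotopic to the identity, together with a
chosen lift to the universal cover.  (A homeomorphism of `A` is isotopic to the identity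
iff it admits a lift commuting with the deck translation and preserving each boundary
line of the strip.) -/
structure AnnulusHomeo where
  toFun : Ann ≃ₜ Ann
  lift : StripA ≃ₜ StripA
  lift_proj : ∀ z : StripA, annProj (lift z) = toFun (annProj z)
  lift_deck : ∀ z : StripA, lift (deckT z) = deckT (lift z)
  lift_bd0 : ∀ z : StripA, (z.2 : ℝ) = 0 → ((lift z).2 : ℝ) = 0

/-- The iterate `f^k`, `k ∈ ℤ`. -/
def AnnulusHomeo.iter (h : AnnulusHomeo) (k : ℤ) : Ann → Ann :=
  fun z => ((h.toFun.toEquiv : Equiv.Perm Ann) ^ k) z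

/-- The iterate `f̃^k` of the lift, `k ∈ ℤ`. -/
def AnnulusHomeo.liftIter (h : AnnulusHomeo) (k : ℤ) : StripA → StripA :=
  fun z => ((h.lift.toEquiv : Equiv.Perm StripA) ^ k) z

/-- `f` is non wandering: every nonempty open set meets one of its forward iterates. -/
def NonWandering (h : AnnulusHomeo) : Prop :=
  ∀ U : Set Ann, IsOpen U → U.Nonempty → ∃ k : ℕ, 0 < k ∧ (h.iter k '' U ∩ U).Nonempty

/-- The closed strip `ℝ × [0,1]` inside the plane. -/
def stripS : Set (ℝ × ℝ) := {p | p.2 ∈ Set.Icc (0:ℝ) 1}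

/-- A positive twist map: a `C¹` diffeomorphism of the annulus, isotopic to the identity,
whose lift `F` to the strip (together with its inverse `G`) is continuously differentiable
and satisfies `∂(p̃₁ ∘ f̃)/∂y > 0`, i.e. the first component of `DF(z)·(0,1)` is positive. -/
structure PositiveTwistMap extends AnnulusHomeo where
  F : ℝ × ℝ → ℝ × ℝ
  F' : ℝ × ℝ → (ℝ × ℝ) →L[ℝ] (ℝ × ℝ)
  G : ℝ × ℝ → ℝ × ℝ
  G' : ℝ × ℝ → (ℝ × ℝ) →L[ℝ] (ℝ × ℝ)
  F_lift : ∀ z : StripA, F (z.1, (z.2 : ℝ)) = ((lift z).1, ((lift z).2 : ℝ))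
  G_lift : ∀ z : StripA, G (z.1, (z.2 : ℝ)) = ((lift.symm z).1, ((lift.symm z).2 : ℝ))
  F_hasDeriv : ∀ z ∈ stripS, HasFDerivWithinAt F (F' z) stripS z
  G_hasDeriv : ∀ z ∈ stripS, HasFDerivWithinAt G (G' z) stripS z
  F'_cont : ContinuousOn F' stripS
  G'_cont : ContinuousOn G' stripS
  twist_pos : ∀ z ∈ stripS, 0 < (F' z (0, 1)).1

/-- The oriented angle (in `(-π, π]`) from the vertical vector `(0,1)` to the vector `w`. -/
def angleFromVertical (w : ℝ × ℝ) : ℝ := Complex.arg ⟨w.2, -w.1⟩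

/-- `ρ` is the rotation number of `f` on the boundary circle `C₀`, computed with the lift. -/
def HasRotNum0 (h : AnnulusHomeo) (ρ : ℝ) : Prop :=
  ∀ x : ℝ, Tendsto (fun n : ℕ => ((h.liftIter (n : ℤ) (bd0 x)).1 - x) / (n : ℝ))
    atTop (𝓝 ρ)

/-- `ρ` is the rotation number of `f` on the boundary circle `C₁`, computed with the lift. -/
def HasRotNum1 (h : AnnulusHomeo) (ρ : ℝ) : Prop :=
  ∀ x : ℝ, Tendsto (fun n : ℕ => ((h.liftIter (n : ℤ) (bd1 x)).1 - x) / (n : ℝ))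
    atTop (𝓝 ρ)

/-- A closed `f`-invariant set `X ⊆ A` is well ordered if the first projection is injective
on `X` and the lift preserves the horizontal order on `π⁻¹(X)`. -/
def IsWellOrdered (h : AnnulusHomeo) (X : Set Ann) : Prop :=
  IsClosed X ∧ h.toFun '' X = X ∧
  Set.InjOn (fun z : Ann => z.1) X ∧
  ∀ z₁ z₂ : StripA, annProj z₁ ∈ X → annProj z₂ ∈ X → z₁.1 < z₂.1 →
    (h.lift z₁).1 < (h.lift z₂).1

/-- An essential simple loop in the annulus: the range of an injective continuous map
from the circle that is not null-homotopic. -/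
def IsEssentialSimpleLoop (Γ : Set Ann) : Prop :=
  ∃ γ : C(𝕋, Ann), Function.Injective γ ∧ ¬ γ.Nullhomotopic ∧ Set.range γ = Γ

/-- `Γ` meets each vertical segment `{x} × [0,1]` in exactly one point. -/
def MeetsVerticalsOnce (Γ : Set Ann) : Prop :=
  ∀ x : 𝕋, ∃! z : Ann, z ∈ Γ ∧ z.1 = x

/-- No essential simple loop meeting each vertical segment exactly once is invariant,
except the two boundary circles. -/
def NoInvariantTransverseLoop (h : AnnulusHomeo) : Prop :=
  ∀ Γ : Set Ann, IsEssentialSimpleLoop Γ → MeetsVerticalsOnce Γ →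
    h.toFun '' Γ = Γ → Γ = C0 ∨ Γ = C1

/-- A continuum: a nonempty compact connected set. -/
def IsContinuum (X : Set Ann) : Prop := X.Nonempty ∧ IsCompact X ∧ IsPreconnected X

/-- A lower annulus: an open set homeomorphic to `𝕋 × [0,1)` containing `C₀`. -/
def IsLowerAnnulus (U : Set Ann) : Prop :=
  IsOpen U ∧ Nonempty (↥U ≃ₜ (𝕋 × ↥(Set.Ico (0:ℝ) 1))) ∧ C0 ⊆ U

/-- A lower disk: an open set homeomorphic to `ℝ × [0,1)` meeting `C₀`. -/
def IsLowerDisk (U : Set Ann) : Prop :=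
  IsOpen U ∧ Nonempty (↥U ≃ₜ (ℝ × ↥(Set.Ico (0:ℝ) 1))) ∧ (U ∩ C0).Nonempty

/-- A lower annulus is regular if it is a connected component of the complement of an
essential simple loop. -/
def IsRegularLowerAnnulus (U : Set Ann) : Prop :=
  ∃ Γ : Set Ann, IsEssentialSimpleLoop Γ ∧ ∃ z : Ann, U = connectedComponentIn Γᶜ z

/-- A lower disk is regular if it is a connected component of the complement of a simple
arc joining two points of `C₀` and meeting `C₀` only at its endpoints, or of the
complement of an essential simple loop meeting `C₀` in exactly one point. -/
def IsRegularLowerDisk (U : Set Ann) : Prop :=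
  (∃ a : C(↥(Set.Icc (0:ℝ) 1), Ann), Function.Injective a ∧
      (∀ t : ↥(Set.Icc (0:ℝ) 1), a t ∈ C0 ↔ ((t : ℝ) = 0 ∨ (t : ℝ) = 1)) ∧
      ∃ z : Ann, U = connectedComponentIn (Set.range a)ᶜ z) ∨
  (∃ Γ : Set Ann, IsEssentialSimpleLoop Γ ∧ (∃! z : Ann, z ∈ Γ ∩ C0) ∧
      ∃ z : Ann, U = connectedComponentIn Γᶜ z)

end

/-- The properties of the lift of an area-preserving positive twist map that are used in the
variational construction. -/
structure IsAreaTwist (e : StripA ≃ₜ StripA) : Prop where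
  deck : ∀ z, e (deckT z) = deckT (e z)
  twist : ∀ x : ℝ, StrictMono fun t : unitInterval => (e (x, t)).1
  symm_twist : ∀ x : ℝ, StrictAnti fun t : unitInterval => (e.symm (x, t)).1
  map_zero : ∀ x : ℝ, (e (x, 0)).2 = 0
  map_one : ∀ x : ℝ, (e (x, 1)).2 = 1
  measurePreserving : MeasurePreserving e volume volume

theorem strictMono_of_continuous_of_injective_of_add_one {φ : ℝ → ℝ} (hc : Continuous φ)
    (hi : Function.Injective φ) (h1 : ∀ x, φ (x + 1) = φ x + 1) : StrictMono φ := by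
  rcases hc.strictMono_of_inj hi with h | h
  · exact h
  · have := h (show (0 : ℝ) < 0 + 1 by norm_num)
    simp only [h1] at this
    linarith

theorem surjective_of_continuous_of_add_one {φ : ℝ → ℝ} (hc : Continuous φ)
    (h1 : ∀ x, φ (x + 1) = φ x + 1) : Function.Surjective φ := by
  have hn : ∀ (n : ℕ) x, φ (x + n) = φ x + n := by
    intro n
    induction n with
    | zero => simp
    | succ k ih =>
      intro x
      push_cast
      rw [← add_assoc, h1, ih]
      ring
  intro c
  obtain ⟨n, hn1⟩ := exists_nat_ge |c - φ 0|
  have h2 := abs_le.1 hn1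
  have h3 := hn n 0
  have h4 := hn n (-n)
  rw [neg_add_cancel] at h4
  rw [zero_add] at h3
  exact mem_range_of_exists_le_of_exists_ge hc ⟨-n, by linarith⟩ ⟨n, by linarith⟩

namespace AnnulusHomeo

variable (h : AnnulusHomeo)

theorem lift_add_one (x : ℝ) (t : unitInterval) :
    h.lift (x + 1, t) = ((h.lift (x, t)).1 + 1, (h.lift (x, t)).2) :=
  h.lift_deck (x, t)

theorem lift_zero_snd (x : ℝ) : (h.lift (x, (0 : unitInterval))).2 = 0 :=
  Subtype.ext (h.lift_bd0 (x, 0) rfl)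

theorem lift_zero_strictMono : StrictMono fun x : ℝ => (h.lift (x, (0 : unitInterval))).1 := by
  refine strictMono_of_continuous_of_injective_of_add_one (by fun_prop) ?_
    (fun x => by rw [lift_add_one])
  intro x y hxy
  have : h.lift (x, (0 : unitInterval)) = h.lift (y, 0) :=
    Prod.ext hxy (by rw [lift_zero_snd, lift_zero_snd])
  simpa using this

theorem lift_zero_surjective :
    Function.Surjective fun x : ℝ => (h.lift (x, (0 : unitInterval))).1 :=
  surjective_of_continuous_of_add_one (by fun_prop) (fun x => by rw [lift_add_one])

theorem lift_symm_zero_snd (c : ℝ) : (h.lift.symm (c, (0 : unitInterval))).2 = 0 := by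
  obtain ⟨s, hs⟩ := h.lift_zero_surjective c
  have : h.lift (s, (0 : unitInterval)) = (c, 0) := Prod.ext hs (h.lift_zero_snd s)
  rw [← this, Homeomorph.symm_apply_apply]

end AnnulusHomeo

namespace PositiveTwistMap

variable (f : PositiveTwistMap)

theorem twist (x : ℝ) : StrictMono fun t : unitInterval => (f.lift (x, t)).1 := by
  have key : StrictMonoOn (fun t : ℝ => (f.F (x, t)).1) (Icc 0 1) := by
    have hd : ∀ t ∈ Icc (0 : ℝ) 1,
        HasDerivWithinAt (fun t : ℝ => (f.F (x, t)).1) (f.F' (x, t) (0, 1)).1 (Icc 0 1) t := by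
      intro t ht
      have h1 := f.F_hasDeriv (x, t) ht
      have h2 : HasDerivWithinAt (fun t : ℝ => (x, t)) ((0 : ℝ), (1 : ℝ)) (Icc 0 1) t :=
        (hasDerivWithinAt_const t _ x).prodMk (hasDerivWithinAt_id t _)
      have h3 := h1.comp_hasDerivWithinAt t h2 (fun s hs => hs)
      exact (ContinuousLinearMap.fst ℝ ℝ ℝ).hasFDerivAt.comp_hasDerivWithinAt t h3
    refine strictMonoOn_of_hasDerivWithinAt_pos (convex_Icc 0 1)
      (fun t ht => (hd t ht).continuousWithinAt)
      (fun t ht => (hd t (interior_subset ht)).mono interior_subset)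
      (fun t ht => f.twist_pos (x, t) ?_)
    exact interior_subset (s := Icc (0 : ℝ) 1) ht
  intro s t hst
  have := key s.2 t.2 hst
  simp only [f.F_lift (x, s), f.F_lift (x, t)] at this
  exact this

theorem lift_symm_twist (c : ℝ) : StrictAnti fun t : unitInterval => (f.lift.symm (c, t)).1 := by
  have hinj : Function.Injective fun t : unitInterval => (f.lift.symm (c, t)).1 := by
    intro s t hst
    have h1 : f.lift.symm (c, s) = ((f.lift.symm (c, s)).1, (f.lift.symm (c, s)).2) := rfl
    have h2 : f.lift.symm (c, t) = ((f.lift.symm (c, s)).1, (f.lift.symm (c, t)).2) :=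
      Prod.ext hst.symm rfl
    have h3 : (f.lift.symm (c, s)).2 = (f.lift.symm (c, t)).2 := by
      apply (f.twist (f.lift.symm (c, s)).1).injective
      change (f.lift _).1 = (f.lift _).1
      rw [← h1, ← h2, Homeomorph.apply_symm_apply, Homeomorph.apply_symm_apply]
    have h4 : f.lift.symm (c, s) = f.lift.symm (c, t) := Prod.ext hst h3
    simpa using h4
  have hcont : Continuous fun t : unitInterval => (f.lift.symm (c, t)).1 := by fun_prop
  rcases hcont.strictMono_of_inj_boundedOrder' hinj with hm | hm
  · exfalso
    have h01 := hm (show (0 : unitInterval) < 1 by norm_num)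
    set z := f.lift.symm (c, (1 : unitInterval)) with hz
    have e0 : f.lift ((f.lift.symm (c, (0 : unitInterval))).1, (0 : unitInterval)) = (c, 0) := by
      have : ((f.lift.symm (c, (0 : unitInterval))).1, (0 : unitInterval))
          = f.lift.symm (c, (0 : unitInterval)) := Prod.ext rfl (f.lift_symm_zero_snd c).symm
      rw [this, Homeomorph.apply_symm_apply]
    have e1 : f.lift (z.1, z.2) = (c, 1) := by
      change f.lift z = _
      rw [hz, Homeomorph.apply_symm_apply]
    have h2 := f.lift_zero_strictMono h01
    have h3 := (f.twist z.1).monotone (show (0 : unitInterval) ≤ z.2 from z.2.2.1)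
    simp only [e0, e1] at h2 h3
    exact absurd h2 (not_lt.2 h3)
  · exact hm

theorem lift_one_snd (x : ℝ) : (f.lift (x, (1 : unitInterval))).2 = 1 := by
  set w := f.lift (x, (1 : unitInterval)) with hw
  by_contra hne
  have hlt1 : (w.2 : ℝ) < 1 := lt_of_le_of_ne w.2.2.2 fun h => hne (Subtype.ext h)
  have hpos : 0 < (w.2 : ℝ) := by
    refine lt_of_le_of_ne w.2.2.1 fun h => ?_
    have h0 : w.2 = 0 := Subtype.ext h.symm
    have h1 := f.lift_symm_zero_snd w.1
    have h2 : (w.1, (0 : unitInterval)) = w := Prod.ext rfl h0.symm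
    rw [h2, hw, Homeomorph.symm_apply_apply] at h1
    exact one_ne_zero h1
  have hmem : ((w.1, (w.2 : ℝ)) : ℝ × ℝ) ∈ stripS := w.2.2
  have hnhds : stripS ∈ 𝓝 ((w.1, (w.2 : ℝ)) : ℝ × ℝ) := by
    have : (Prod.snd : ℝ × ℝ → ℝ) ⁻¹' Icc 0 1 ∈ 𝓝 ((w.1, (w.2 : ℝ)) : ℝ × ℝ) :=
      continuous_snd.continuousAt.preimage_mem_nhds (Icc_mem_nhds hpos hlt1)
    exact this
  have hG := (f.G_hasDeriv _ hmem).hasFDerivAt hnhds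
  have hG2 : HasFDerivAt (fun v => (f.G v).2)
      ((ContinuousLinearMap.snd ℝ ℝ ℝ).comp (f.G' (w.1, (w.2 : ℝ)))) (w.1, (w.2 : ℝ)) :=
    (ContinuousLinearMap.snd ℝ ℝ ℝ).hasFDerivAt.comp _ hG
  have hGF : ∀ t : unitInterval, f.G (f.F (x, (t : ℝ))) = (x, (t : ℝ)) := by
    intro t
    rw [f.F_lift (x, t), f.G_lift (f.lift (x, t)), Homeomorph.symm_apply_apply]
  have hF1 : f.F (x, (1 : ℝ)) = (w.1, (w.2 : ℝ)) := f.F_lift (x, 1)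
  have hGw : f.G (w.1, (w.2 : ℝ)) = (x, 1) := by
    rw [← hF1]
    exact hGF 1
  have hmax : IsLocalMax (fun v => (f.G v).2) (w.1, (w.2 : ℝ)) := by
    filter_upwards [hnhds] with v hv
    have := f.G_lift (v.1, ⟨v.2, hv⟩)
    simp only [Prod.mk.eta] at this
    rw [this, hGw]
    exact (f.lift.symm (v.1, ⟨v.2, hv⟩)).2.2.2
  have hzero := hmax.hasFDerivAt_eq_zero hG2
  have h1mem : (1 : ℝ) ∈ Icc (0 : ℝ) 1 := by norm_num
  have hd : HasDerivWithinAt (fun t : ℝ => (f.G (f.F (x, t))).2) 0 (Icc 0 1) 1 := by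
    have h2 : HasDerivWithinAt (fun t : ℝ => (x, t)) ((0 : ℝ), (1 : ℝ)) (Icc 0 1) 1 :=
      (hasDerivWithinAt_const 1 _ x).prodMk (hasDerivWithinAt_id 1 _)
    have h3 := (f.F_hasDeriv (x, 1) h1mem).comp_hasDerivWithinAt 1 h2 (fun s hs => hs)
    have h4 := HasFDerivAt.comp_hasDerivWithinAt (l := fun v => (f.G v).2)
      (l' := (ContinuousLinearMap.snd ℝ ℝ ℝ).comp (f.G' (w.1, (w.2 : ℝ)))) 1
      (by rw [Function.comp_apply, hF1]; exact hG2) h3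
    rw [hzero] at h4
    exact h4
  have hid : HasDerivWithinAt (fun t : ℝ => (f.G (f.F (x, t))).2) 1 (Icc 0 1) 1 :=
    (hasDerivWithinAt_id 1 _).congr (fun t ht => by rw [hGF ⟨t, ht⟩]; rfl)
      (by rw [hF1, hGw]; rfl)
  have := (uniqueDiffOn_Icc (zero_lt_one' ℝ) 1 h1mem).eq_deriv _ hd hid
  exact zero_ne_one this

end PositiveTwistMap

theorem measurePreserving_annProj (m : ℤ) :
    MeasurePreserving annProj
      (volume.restrict (Ioc (m : ℝ) (m + 1) ×ˢ (univ : Set unitInterval))) volume := by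
  have h1 := AddCircle.measurePreserving_mk (1 : ℝ) (m : ℝ)
  have h2 := h1.prod (MeasurePreserving.id (volume : Measure unitInterval))
  have h3 : (volume.restrict (Ioc (m : ℝ) (m + 1))).prod (volume : Measure unitInterval)
      = volume.restrict (Ioc (m : ℝ) (m + 1) ×ˢ (univ : Set unitInterval)) := by
    conv_lhs => rw [← Measure.restrict_univ (μ := (volume : Measure unitInterval))]
    rw [Measure.prod_restrict]
    rfl
  rw [← h3]
  exact h2

theorem continuous_annProj : Continuous annProj :=
  ((AddCircle.continuous_mk' (1 : ℝ)).comp continuous_fst).prodMk continuous_snd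

theorem isOpenMap_annProj : IsOpenMap annProj :=
  (QuotientAddGroup.isOpenMap_coe (N := AddSubgroup.zmultiples (1 : ℝ))).prodMap IsOpenMap.id

theorem annProj_surjective : Function.Surjective annProj := by
  rintro ⟨x, y⟩
  obtain ⟨x, rfl⟩ := QuotientAddGroup.mk_surjective x
  exact ⟨(x, y), rfl⟩

theorem annProj_deckZ (n : ℤ) (z : StripA) : annProj (deckZ n z) = annProj z :=
  Prod.ext (by simp [annProj, deckZ]) rfl

theorem exists_eq_add_of_coe_eq {x y : ℝ} (h : (x : 𝕋) = (y : 𝕋)) : ∃ n : ℤ, y = x + n := by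
  have h1 : ((y - x : ℝ) : 𝕋) = 0 := by rw [AddCircle.coe_sub, h, sub_self]
  obtain ⟨n, hn⟩ := (AddCircle.coe_eq_zero_iff (1 : ℝ)).1 h1
  refine ⟨n, ?_⟩
  simp only [zsmul_eq_mul, mul_one] at hn
  linarith

theorem exists_deckZ_of_annProj_eq {z w : StripA} (h : annProj z = annProj w) :
    ∃ n : ℤ, w = deckZ n z := by
  obtain ⟨n, hn⟩ := exists_eq_add_of_coe_eq (congrArg Prod.fst h)
  exact ⟨n, Prod.ext hn (congrArg Prod.snd h).symm⟩

theorem annProj_injOn (m : ℤ) : InjOn annProj (Ioc (m : ℝ) (m + 1) ×ˢ (univ : Set unitInterval)) := by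
  intro z hz w hw h
  exact Prod.ext ((AddCircle.coe_eq_coe_iff_of_mem_Ioc hz.1 hw.1).1 (congrArg Prod.fst h))
    (congrArg Prod.snd h : (annProj z).2 = (annProj w).2)

theorem measurableSet_annProj_image {m : ℤ} {B : Set StripA} (hB : MeasurableSet B)
    (hBm : B ⊆ Ioc (m : ℝ) (m + 1) ×ˢ univ) : MeasurableSet (annProj '' B) :=
  hB.image_of_continuousOn_injOn continuous_annProj.continuousOn ((annProj_injOn m).mono hBm)

theorem volume_annProj_image {m : ℤ} {B : Set StripA} (hB : MeasurableSet B)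
    (hBm : B ⊆ Ioc (m : ℝ) (m + 1) ×ˢ univ) : volume (annProj '' B) = volume B := by
  have hm := measurableSet_annProj_image hB hBm
  rw [← (measurePreserving_annProj m).measure_preimage hm.nullMeasurableSet,
    Measure.restrict_apply (continuous_annProj.measurable hm)]
  congr 1
  ext z
  constructor
  · rintro ⟨⟨w, hw, hwz⟩, hz⟩
    rwa [← annProj_injOn m (hBm hw) hz hwz]
  · intro hz
    exact ⟨⟨z, hz, rfl⟩, hBm hz⟩

theorem AnnulusHomeo.measurePreserving_lift (h : AnnulusHomeo)
    (hArea : MeasurePreserving h.toFun volume volume) :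
    MeasurePreserving h.lift volume volume := by
  have himg : ∀ A : Set StripA, MeasurableSet A → volume (h.lift '' A) = volume A := by
    intro A hA
    let κ : StripA → ℤ × ℤ := fun z => (⌈z.1⌉ - 1, ⌈(h.lift z).1⌉ - 1)
    have hκ : Measurable κ :=
      ((Int.measurable_ceil.comp measurable_fst).sub_const 1).prodMk
        ((Int.measurable_ceil.comp (measurable_fst.comp h.lift.continuous.measurable)).sub_const 1)
    have hceil : ∀ (x : ℝ) (m : ℤ), ⌈x⌉ - 1 = m → x ∈ Ioc (m : ℝ) (m + 1) := by
      intro x m hx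
      have h1 : ⌈x⌉ = m + 1 := by omega
      have h2 := Int.ceil_eq_iff.1 h1
      push_cast at h2
      exact ⟨by linarith [h2.1], h2.2⟩
    let P : ℤ × ℤ → Set StripA := fun p => A ∩ κ ⁻¹' {p}
    have hPm : ∀ p, MeasurableSet (P p) := fun p => hA.inter (hκ (measurableSet_singleton p))
    have hU : A = ⋃ p, P p := by
      ext z
      simp [P]
    have hdisj : Pairwise (Function.onFun Disjoint P) := by
      intro p q hpq
      refine Set.disjoint_left.2 ?_
      rintro z ⟨-, hz⟩ ⟨-, hz'⟩
      exact hpq (hz.symm.trans hz')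
    have himgm : ∀ p, MeasurableSet (h.lift '' P p) := fun p =>
      h.lift.toMeasurableEquiv.measurableSet_image.2 (hPm p)
    have hdisj' : Pairwise (Function.onFun Disjoint fun p => h.lift '' P p) := fun p q hpq =>
      (disjoint_image_iff h.lift.injective).2 (hdisj hpq)
    have hpiece : ∀ p, volume (h.lift '' P p) = volume (P p) := by
      rintro ⟨m, n⟩
      have h1 : P (m, n) ⊆ Ioc (m : ℝ) (m + 1) ×ˢ univ := fun z hz =>
        ⟨hceil _ _ (congrArg Prod.fst hz.2), trivial⟩
      have h2 : h.lift '' P (m, n) ⊆ Ioc (n : ℝ) (n + 1) ×ˢ univ := by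
        rintro _ ⟨z, hz, rfl⟩
        exact ⟨hceil _ _ (congrArg Prod.snd hz.2), trivial⟩
      rw [← volume_annProj_image (himgm _) h2, ← volume_annProj_image (hPm _) h1]
      have h3 : annProj '' P (m, n) = h.toFun ⁻¹' (annProj '' (h.lift '' P (m, n))) := by
        have : annProj '' (h.lift '' P (m, n)) = h.toFun '' (annProj '' P (m, n)) := by
          simp only [image_image, h.lift_proj]
        rw [this, preimage_image_eq _ h.toFun.injective]
      rw [h3, hArea.measure_preimage
        (measurableSet_annProj_image (himgm _) h2).nullMeasurableSet]
    rw [hU, image_iUnion, measure_iUnion hdisj' himgm, measure_iUnion hdisj hPm]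
    exact tsum_congr hpiece
  refine ⟨h.lift.continuous.measurable, Measure.ext fun S hS => ?_⟩
  rw [Measure.map_apply h.lift.continuous.measurable hS, ← himg _ (h.lift.continuous.measurable hS),
    image_preimage_eq _ h.lift.surjective]

theorem PositiveTwistMap.isAreaTwist (f : PositiveTwistMap)
    (hArea : MeasurePreserving f.toFun volume volume) : IsAreaTwist f.lift where
  deck := f.lift_deck
  twist := f.twist
  symm_twist := f.lift_symm_twist
  map_zero := f.lift_zero_snd
  map_one := f.lift_one_snd
  measurePreserving := f.measurePreserving_lift hArea

theorem deckZ_add (m n : ℤ) (z : StripA) : deckZ (m + n) z = deckZ m (deckZ n z) :=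
  Prod.ext (by simp only [deckZ]; push_cast; ring) rfl

theorem deckZ_zero (z : StripA) : deckZ 0 z = z :=
  Prod.ext (by simp [deckZ]) rfl

theorem deckZ_one (z : StripA) : deckZ 1 z = deckT z :=
  Prod.ext (by simp [deckZ, deckT]) rfl

theorem measurePreserving_deckZ (n : ℤ) : MeasurePreserving (deckZ n) volume volume :=
  (measurePreserving_add_right (volume : Measure ℝ) (n : ℝ)).prod
    (MeasurePreserving.id (volume : Measure unitInterval))

/-- A function whose increments are integrals of a continuous function is differentiable. -/
theorem hasDerivAt_of_sub_eq_integral {B L : ℝ → ℝ} (hL : Continuous L)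
    (h : ∀ a b, a ≤ b → B b - B a = ∫ s in a..b, L s) (x : ℝ) : HasDerivAt B (L x) x := by
  have hB : B = fun s => B x + ∫ r in x..s, L r := by
    funext s
    rcases le_total x s with hs | hs
    · rw [← h x s hs]
      ring
    · rw [intervalIntegral.integral_symm, ← h s x hs]
      ring
  rw [hB]
  exact ((hL.integral_hasStrictDerivAt x x).hasDerivAt).const_add _

/-- Fubini's theorem for a bounded vertical slab of a measurable subset of the strip. -/
theorem measureReal_slab {S : Set StripA} (hS : MeasurableSet S) {a b : ℝ} (hab : a ≤ b) :
    (volume : Measure StripA).real (S ∩ {z | a < z.1 ∧ z.1 ≤ b}) =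
      ∫ s in a..b, (volume : Measure unitInterval).real {t | (s, t) ∈ S} := by
  have hm : MeasurableSet (S ∩ {z : StripA | a < z.1 ∧ z.1 ≤ b}) :=
    hS.inter (measurable_fst measurableSet_Ioc)
  have hslice : ∀ s, MeasurableSet {t : unitInterval | (s, t) ∈ S} := fun s =>
    measurable_prodMk_left hS
  have hmeas : Measurable fun s : ℝ => (volume : Measure unitInterval) {t | (s, t) ∈ S} :=
    measurable_measure_prodMk_left hS
  rw [intervalIntegral.integral_of_le hab]
  simp only [measureReal_def]
  rw [integral_toReal hmeas.aemeasurable (Eventually.of_forall fun s => measure_lt_top _ _)]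
  congr 1
  rw [Measure.volume_eq_prod, Measure.prod_apply hm, ← lintegral_indicator measurableSet_Ioc]
  congr 1
  funext s
  by_cases hs : s ∈ Ioc a b
  · rw [indicator_of_mem hs]
    congr 1
    ext t
    simp only [mem_preimage, mem_inter_iff, mem_ofPred_eq]
    exact and_iff_left hs
  · rw [indicator_of_notMem hs]
    convert measure_empty (μ := (volume : Measure unitInterval)) using 2
    ext t
    simp only [mem_preimage, mem_inter_iff, mem_ofPred_eq, mem_empty_iff_false, iff_false, not_and]
    exact fun _ h h' => hs ⟨h, h'⟩

namespace IsAreaTwist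

variable {e : StripA ≃ₜ StripA} (he : IsAreaTwist e)

include he

theorem map_deckZ (n : ℤ) (z : StripA) : e (deckZ n z) = deckZ n (e z) := by
  induction n generalizing z with
  | zero => simp only [deckZ_zero]
  | succ n ih => rw [deckZ_add, ih, deckZ_one, he.deck, ← deckZ_one, ← deckZ_add]
  | pred n ih =>
    have h1 : ∀ w, deckZ (-(n : ℤ)) w = deckT (deckZ (-(n : ℤ) - 1) w) := fun w => by
      rw [← deckZ_one, ← deckZ_add]
      congr 1
      ring
    have h2 := ih z
    rw [h1, h1, he.deck] at h2
    have h3 : Function.Injective deckT := fun a b hab => by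
      simpa [deckT, Prod.ext_iff] using hab
    exact h3 h2

theorem symm_map_deckZ (n : ℤ) (z : StripA) : e.symm (deckZ n z) = deckZ n (e.symm z) := by
  rw [Homeomorph.symm_apply_eq, he.map_deckZ, Homeomorph.apply_symm_apply]

/-- The horizontal displacement is bounded. -/
theorem exists_displacement_bound : ∃ C : ℝ, 0 ≤ C ∧ ∀ z : StripA, |(e z).1 - z.1| ≤ C := by
  have hc : Continuous fun z : StripA => |(e z).1 - z.1| := by fun_prop
  have hK : IsCompact (Icc (0 : ℝ) 1 ×ˢ (univ : Set unitInterval)) :=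
    isCompact_Icc.prod isCompact_univ
  obtain ⟨C, hC⟩ := hK.bddAbove_image hc.continuousOn
  refine ⟨max C 0, le_max_right _ _, fun z => le_max_of_le_left ?_⟩
  have h1 : |(e (deckZ (-⌊z.1⌋) z)).1 - (deckZ (-⌊z.1⌋) z).1| ≤ C := by
    refine hC ⟨deckZ (-⌊z.1⌋) z, ⟨?_, trivial⟩, rfl⟩
    simp only [deckZ]
    push_cast
    exact ⟨by linarith [Int.floor_le z.1], by linarith [Int.lt_floor_add_one z.1]⟩
  rw [he.map_deckZ] at h1
  simpa [deckZ] using h1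

end IsAreaTwist

/-- The generating function: the area of the points to the right of abscissa `x` that are mapped
to the left of abscissa `c`. -/
noncomputable def genFun (e : StripA ≃ₜ StripA) (x c : ℝ) : ℝ :=
  (volume : Measure StripA).real {z | x < z.1 ∧ (e z).1 ≤ c}

/-- The height of the part of the vertical over `x` that is mapped to the left of `c`. -/
noncomputable def heightOut (e : StripA ≃ₜ StripA) (x c : ℝ) : ℝ :=
  (volume : Measure unitInterval).real {t | (e (x, t)).1 ≤ c}

/-- The height of the part of the vertical over `c` that comes from the right of `x`. -/
noncomputable def heightIn (e : StripA ≃ₜ StripA) (x c : ℝ) : ℝ :=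
  (volume : Measure unitInterval).real {t | x < (e.symm (c, t)).1}

theorem measurableSet_genFun (e : StripA ≃ₜ StripA) (x c : ℝ) :
    MeasurableSet {z : StripA | x < z.1 ∧ (e z).1 ≤ c} := by
  have h : Measurable fun z => (e z).1 := measurable_fst.comp e.continuous.measurable
  exact (measurableSet_lt measurable_const measurable_fst).inter
    (measurableSet_le h measurable_const)

theorem measurableSet_genFun_symm (e : StripA ≃ₜ StripA) (x c : ℝ) :
    MeasurableSet {w : StripA | x < (e.symm w).1 ∧ w.1 ≤ c} := by
  have h : Measurable fun z => (e.symm z).1 := measurable_fst.comp e.symm.continuous.measurable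
  exact (measurableSet_lt measurable_const h).inter
    (measurableSet_le measurable_fst measurable_const)

theorem continuous_measureReal_of_forall {P : ℝ → Set unitInterval}
    (hP : ∀ x, MeasurableSet (P x))
    (h : ∀ x₀, ∀ᵐ t, ∀ᶠ x in 𝓝 x₀, (t ∈ P x ↔ t ∈ P x₀)) :
    Continuous fun x => (volume : Measure unitInterval).real (P x) := by
  have h1 : (fun x => (volume : Measure unitInterval).real (P x)) =
      fun x => ∫ t, (P x).indicator (fun _ => (1 : ℝ)) t := by
    funext x
    rw [integral_indicator (hP x)]
    simp
  rw [h1]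
  refine continuous_iff_continuousAt.2 fun x₀ => ?_
  refine continuousAt_of_dominated (bound := fun _ => 1)
    (Eventually.of_forall fun x => (measurable_const.indicator (hP x)).aestronglyMeasurable)
    (Eventually.of_forall fun x => Eventually.of_forall fun t => ?_) (integrable_const _) ?_
  · by_cases ht : t ∈ P x <;> simp [ht]
  · filter_upwards [h x₀] with t ht
    refine (continuousAt_const (y := (P x₀).indicator (fun _ => (1 : ℝ)) t)).congr ?_
    filter_upwards [ht] with x hx
    by_cases hx0 : t ∈ P x₀
    · simp [hx0, hx.2 hx0]
    · simp [hx0, mt hx.1 hx0]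

namespace IsAreaTwist

variable {e : StripA ≃ₜ StripA} (he : IsAreaTwist e)

include he

theorem continuous_heightOut (c : ℝ) : Continuous fun x => heightOut e x c := by
  refine continuous_measureReal_of_forall (fun x => ?_) (fun x₀ => ?_)
  · exact measurableSet_le (by fun_prop) measurable_const
  · have hsub : {t : unitInterval | (e (x₀, t)).1 = c}.Subsingleton := fun s hs t ht =>
      (he.twist x₀).injective (hs.trans ht.symm)
    have hnull : (volume : Measure unitInterval) {t | (e (x₀, t)).1 = c} = 0 :=
      hsub.measure_zero _
    filter_upwards [measure_eq_zero_iff_ae_notMem.1 hnull] with t ht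
    have hc : ContinuousAt (fun x => (e (x, t)).1) x₀ := by fun_prop
    rcases lt_or_gt_of_ne ht with h | h
    · filter_upwards [hc.eventually (gt_mem_nhds h)] with x hx
      simp only [hx.le, h.le]
    · filter_upwards [hc.eventually (lt_mem_nhds h)] with x hx
      simp only [not_le.2 hx, not_le.2 h]

theorem continuous_heightIn (x : ℝ) : Continuous fun c => heightIn e x c := by
  refine continuous_measureReal_of_forall (fun c => ?_) (fun c₀ => ?_)
  · exact measurableSet_lt measurable_const (by fun_prop)
  · have hsub : {t : unitInterval | (e.symm (c₀, t)).1 = x}.Subsingleton := fun s hs t ht =>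
      (he.symm_twist c₀).injective (hs.trans ht.symm)
    have hnull : (volume : Measure unitInterval) {t | (e.symm (c₀, t)).1 = x} = 0 :=
      hsub.measure_zero _
    filter_upwards [measure_eq_zero_iff_ae_notMem.1 hnull] with t ht
    have hc : ContinuousAt (fun c => (e.symm (c, t)).1) c₀ := by fun_prop
    rcases lt_or_gt_of_ne ht with h | h
    · filter_upwards [hc.eventually (gt_mem_nhds h)] with c hcx
      simp only [not_lt.2 hcx.le, not_lt.2 h.le]
    · filter_upwards [hc.eventually (lt_mem_nhds h)] with c hcx
      simp only [hcx, gt_iff_lt.1 h]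

theorem measure_genFun_ne_top (x c : ℝ) :
    (volume : Measure StripA) {z | x < z.1 ∧ (e z).1 ≤ c} ≠ ⊤ := by
  obtain ⟨C, -, hC⟩ := he.exists_displacement_bound
  have hsub : {z : StripA | x < z.1 ∧ (e z).1 ≤ c} ⊆ Icc x (c + C) ×ˢ univ := by
    rintro z ⟨h1, h2⟩
    have := abs_le.1 (hC z)
    exact ⟨⟨h1.le, by linarith⟩, trivial⟩
  exact ne_top_of_le_ne_top (isCompact_Icc.prod isCompact_univ).measure_lt_top.ne (measure_mono hsub)

theorem genFun_eq_symm (x c : ℝ) :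
    genFun e x c = (volume : Measure StripA).real {w | x < (e.symm w).1 ∧ w.1 ≤ c} := by
  have hm := measurableSet_genFun_symm e x c
  rw [genFun, ← he.measurePreserving.measureReal_preimage hm.nullMeasurableSet]
  congr 1
  ext z
  simp

theorem hasDerivAt_genFun_fst (x c : ℝ) :
    HasDerivAt (fun x => genFun e x c) (-heightOut e x c) x := by
  have key : ∀ a b, a ≤ b → -genFun e b c - -genFun e a c = ∫ s in a..b, heightOut e s c := by
    intro a b hab
    have hS : MeasurableSet {z : StripA | (e z).1 ≤ c} :=
      measurableSet_le (by fun_prop) measurable_const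
    have h1 := measureReal_slab hS hab
    have h2 := measureReal_union
      (μ := (volume : Measure StripA)) (s₁ := {z : StripA | (e z).1 ≤ c} ∩ {z | a < z.1 ∧ z.1 ≤ b})
      (s₂ := {z : StripA | b < z.1 ∧ (e z).1 ≤ c}) 
      (Set.disjoint_left.2 fun z hz hz' => not_lt.2 hz.2.2 hz'.1) (measurableSet_genFun e b c)
      (ne_top_of_le_ne_top (he.measure_genFun_ne_top a c)
        (measure_mono fun z hz => ⟨hz.2.1, hz.1⟩)) (he.measure_genFun_ne_top b c)
    have h3 : ({z : StripA | (e z).1 ≤ c} ∩ {z | a < z.1 ∧ z.1 ≤ b}) ∪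
        {z : StripA | b < z.1 ∧ (e z).1 ≤ c} = {z : StripA | a < z.1 ∧ (e z).1 ≤ c} := by
      ext z
      simp only [mem_union, mem_inter_iff, mem_ofPred_eq]
      constructor
      · rintro (h | h)
        · exact ⟨h.2.1, h.1⟩
        · exact ⟨hab.trans_lt h.1, h.2⟩
      · intro h
        rcases le_or_gt z.1 b with hb | hb
        · exact Or.inl ⟨h.2, h.1, hb⟩
        · exact Or.inr ⟨hb, h.2⟩
    rw [h3, h1] at h2
    simp only [genFun, heightOut]
    simp only [mem_ofPred_eq] at h2
    linarith
  have h := (hasDerivAt_of_sub_eq_integral (he.continuous_heightOut c) key x).neg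
  simp only [Pi.neg_def, neg_neg] at h
  exact h

theorem hasDerivAt_genFun_snd (x c : ℝ) :
    HasDerivAt (fun c => genFun e x c) (heightIn e x c) c := by
  have hfin : ∀ c, (volume : Measure StripA) {w | x < (e.symm w).1 ∧ w.1 ≤ c} ≠ ⊤ := by
    intro c
    have hm := measurableSet_genFun_symm e x c
    rw [← he.measurePreserving.measure_preimage hm.nullMeasurableSet]
    convert he.measure_genFun_ne_top x c using 3
    ext z
    simp
  have key : ∀ a b, a ≤ b → genFun e x b - genFun e x a = ∫ s in a..b, heightIn e x s := by
    intro a b hab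
    have hS : MeasurableSet {w : StripA | x < (e.symm w).1} :=
      measurableSet_lt measurable_const (by fun_prop)
    have h1 := measureReal_slab hS hab
    have h2 := measureReal_union
      (μ := (volume : Measure StripA)) (s₁ := {w : StripA | x < (e.symm w).1 ∧ w.1 ≤ a})
      (s₂ := {w : StripA | x < (e.symm w).1} ∩ {z | a < z.1 ∧ z.1 ≤ b})
      (Set.disjoint_left.2 fun z hz hz' => not_lt.2 hz.2 hz'.2.1)
      (hS.inter (measurable_fst measurableSet_Ioc)) (hfin a)
      (ne_top_of_le_ne_top (hfin b) (measure_mono fun z hz => ⟨hz.1, hz.2.2⟩))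
    have h3 : {w : StripA | x < (e.symm w).1 ∧ w.1 ≤ a} ∪
        ({w : StripA | x < (e.symm w).1} ∩ {z | a < z.1 ∧ z.1 ≤ b}) =
        {w : StripA | x < (e.symm w).1 ∧ w.1 ≤ b} := by
      ext z
      simp only [mem_union, mem_inter_iff, mem_ofPred_eq]
      constructor
      · rintro (h | h)
        · exact ⟨h.1, h.2.trans hab⟩
        · exact ⟨h.1, h.2.2⟩
      · intro h
        rcases le_or_gt z.1 a with hb | hb
        · exact Or.inl ⟨h.1, hb⟩
        · exact Or.inr ⟨h.1, hb, h.2⟩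
    rw [h3, h1] at h2
    simp only [he.genFun_eq_symm, heightIn]
    simp only [mem_ofPred_eq] at h2
    linarith
  exact hasDerivAt_of_sub_eq_integral (he.continuous_heightIn x) key c

theorem continuous_genFun : Continuous fun v : ℝ × ℝ => genFun e v.1 v.2 := by
  have h1 : ∀ c, LipschitzWith 1 fun x => genFun e x c := fun c =>
    lipschitzWith_of_nnnorm_deriv_le (fun x => (he.hasDerivAt_genFun_fst x c).differentiableAt)
      fun x => by
        rw [(he.hasDerivAt_genFun_fst x c).deriv, nnnorm_neg, ← NNReal.coe_le_coe, coe_nnnorm,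
          heightOut, Real.norm_of_nonneg measureReal_nonneg]
        exact measureReal_le_one
  have h2 : ∀ x, LipschitzWith 1 fun c => genFun e x c := fun x =>
    lipschitzWith_of_nnnorm_deriv_le (fun c => (he.hasDerivAt_genFun_snd x c).differentiableAt)
      fun c => by
        rw [(he.hasDerivAt_genFun_snd x c).deriv, ← NNReal.coe_le_coe, coe_nnnorm,
          heightIn, Real.norm_of_nonneg measureReal_nonneg]
        exact measureReal_le_one
  exact (LipschitzWith.uncurry h1 h2).continuous

theorem genFun_add_int (n : ℤ) (x c : ℝ) : genFun e (x + n) (c + n) = genFun e x c := by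
  rw [genFun, genFun,
    ← (measurePreserving_deckZ n).measureReal_preimage (measurableSet_genFun e _ _).nullMeasurableSet]
  congr 1
  ext z
  simp only [mem_preimage, mem_ofPred_eq, he.map_deckZ]
  simp [deckZ]

theorem exists_le_genFun : ∃ C : ℝ, ∀ x c, c - x - C ≤ genFun e x c := by
  obtain ⟨C, -, hC⟩ := he.exists_displacement_bound
  refine ⟨C, fun x c => ?_⟩
  rcases le_total (c - C) x with h | h
  · exact le_trans (by linarith) measureReal_nonneg
  · have h1 := measureReal_slab (S := univ) MeasurableSet.univ h
    simp only [univ_inter, mem_univ, ofPred_true, probReal_univ, intervalIntegral.integral_const,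
      smul_eq_mul, mul_one] at h1
    calc c - x - C = c - C - x := by ring
      _ = _ := h1.symm
      _ ≤ genFun e x c := by
        refine measureReal_mono (fun z hz => ⟨hz.1, ?_⟩) (he.measure_genFun_ne_top x c)
        have := abs_le.1 (hC z)
        linarith [hz.2]

/-- Submodularity of the generating function. -/
theorem genFun_exchange {x u c d : ℝ} (hxu : x ≤ u) (hdc : d ≤ c) :
    genFun e x d + genFun e u c ≤ genFun e x c + genFun e u d := by
  have h := measureReal_union_add_inter (μ := (volume : Measure StripA))
    (s := {z : StripA | x < z.1 ∧ (e z).1 ≤ d}) (t := {z : StripA | u < z.1 ∧ (e z).1 ≤ c})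
    (measurableSet_genFun e u c) (he.measure_genFun_ne_top x d) (he.measure_genFun_ne_top u c)
  rw [genFun, genFun, ← h]
  refine add_le_add (measureReal_mono ?_ (he.measure_genFun_ne_top x c))
    (measureReal_mono ?_ (he.measure_genFun_ne_top u d))
  · rintro z (hz | hz)
    · exact ⟨hz.1, hz.2.trans hdc⟩
    · exact ⟨hxu.trans_lt hz.1, hz.2⟩
  · rintro z ⟨hz, hz'⟩
    exact ⟨hz'.1, hz.2⟩

theorem genFun_min_add_genFun_max (a b c d : ℝ) :
    genFun e (min a b) (min c d) + genFun e (max a b) (max c d) ≤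
      genFun e a c + genFun e b d := by
  rcases le_total a b with h1 | h1 <;> rcases le_total c d with h2 | h2 <;>
    simp only [h1, h2, min_eq_left, min_eq_right, max_eq_left, max_eq_right]
  · exact le_rfl
  · exact he.genFun_exchange h1 h2
  · linarith [he.genFun_exchange h1 h2]
  · linarith

theorem heightOut_of_apply_eq {x c : ℝ} {t : unitInterval} (h : (e (x, t)).1 = c) :
    heightOut e x c = t := by
  have : {s : unitInterval | (e (x, s)).1 ≤ c} = Iic t := by
    ext s
    rw [← h]
    exact (he.twist x).le_iff_le
  rw [heightOut, this, measureReal_def, unitInterval.volume_Iic, ENNReal.toReal_ofReal t.2.1]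

theorem heightIn_of_apply_eq {x c : ℝ} {t : unitInterval} (h : (e (x, t)).1 = c) :
    heightIn e x c = (e (x, t)).2 := by
  have h2 : e.symm (c, (e (x, t)).2) = (x, t) := by
    rw [← h, Prod.mk.eta, Homeomorph.symm_apply_apply]
  have : {s : unitInterval | x < (e.symm (c, s)).1} = Iio (e (x, t)).2 := by
    ext s
    have h3 := (he.symm_twist c).lt_iff_gt (a := (e (x, t)).2) (b := s)
    simp only [h2] at h3
    exact h3
  rw [heightIn, this, measureReal_def, unitInterval.volume_Iio,
    ENNReal.toReal_ofReal (e (x, t)).2.2.1]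

theorem strictMono_zero : StrictMono fun x : ℝ => (e (x, (0 : unitInterval))).1 := by
  refine strictMono_of_continuous_of_injective_of_add_one (by fun_prop) (fun x y hxy => ?_)
    (fun x => congrArg Prod.fst (he.deck (x, 0)))
  have : e (x, (0 : unitInterval)) = e (y, 0) :=
    Prod.ext hxy (by rw [he.map_zero, he.map_zero])
  simpa using this

theorem strictMono_one : StrictMono fun x : ℝ => (e (x, (1 : unitInterval))).1 := by
  refine strictMono_of_continuous_of_injective_of_add_one (by fun_prop) (fun x y hxy => ?_)
    (fun x => congrArg Prod.fst (he.deck (x, 1)))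
  have : e (x, (1 : unitInterval)) = e (y, 1) :=
    Prod.ext hxy (by rw [he.map_one, he.map_one])
  simpa using this

theorem apply_zero_le (z : StripA) : (e (z.1, (0 : unitInterval))).1 ≤ (e z).1 :=
  (he.twist z.1).monotone (show (0 : unitInterval) ≤ z.2 from z.2.2.1)

theorem le_apply_one (z : StripA) : (e z).1 ≤ (e (z.1, (1 : unitInterval))).1 :=
  (he.twist z.1).monotone (show z.2 ≤ (1 : unitInterval) from z.2.2.2)

theorem height_of_lt {x c : ℝ} (h : c < (e (x, (0 : unitInterval))).1) :
    heightOut e x c = 0 ∧ heightIn e x c = 0 := by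
  constructor
  · have : {s : unitInterval | (e (x, s)).1 ≤ c} = ∅ := by
      ext s
      simpa using h.trans_le (he.apply_zero_le (x, s))
    rw [heightOut, this, measureReal_empty]
  · have : {s : unitInterval | x < (e.symm (c, s)).1} = ∅ := by
      ext s
      simp only [mem_ofPred_eq, mem_empty_iff_false, iff_false]
      intro hs
      have h1 := he.strictMono_zero hs
      have h2 := he.apply_zero_le (e.symm (c, s))
      rw [Homeomorph.apply_symm_apply] at h2
      simp only at h1 h2
      linarith
    rw [heightIn, this, measureReal_empty]

theorem height_of_gt {x c : ℝ} (h : (e (x, (1 : unitInterval))).1 < c) :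
    heightOut e x c = 1 ∧ heightIn e x c = 1 := by
  constructor
  · have : {s : unitInterval | (e (x, s)).1 ≤ c} = univ := by
      ext s
      simpa using (he.le_apply_one (x, s)).trans h.le
    rw [heightOut, this, probReal_univ]
  · have : {s : unitInterval | x < (e.symm (c, s)).1} = univ := by
      ext s
      simp only [mem_ofPred_eq, mem_univ, iff_true]
      by_contra hs
      have h1 := he.strictMono_one.monotone (not_lt.1 hs)
      have h2 := he.le_apply_one (e.symm (c, s))
      rw [Homeomorph.apply_symm_apply] at h2
      simp only at h1 h2
      linarith
    rw [heightIn, this, probReal_univ]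

omit he in
theorem trichotomy (x c : ℝ) : c < (e (x, (0 : unitInterval))).1 ∨
    (∃ t, (e (x, t)).1 = c) ∨ (e (x, (1 : unitInterval))).1 < c := by
  rcases lt_or_ge c (e (x, (0 : unitInterval))).1 with h | h
  · exact Or.inl h
  rcases lt_or_ge (e (x, (1 : unitInterval))).1 c with h' | h'
  · exact Or.inr (Or.inr h')
  · have hc : Continuous fun t : unitInterval => (e (x, t)).1 := by fun_prop
    exact Or.inr (Or.inl (mem_range_of_exists_le_of_exists_ge hc ⟨0, h⟩ ⟨1, h'⟩))

end IsAreaTwist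

/-- Periodic configurations of type `(p, q)`. -/
def IsPeriodicConf (q : ℕ) (p : ℤ) (x : ℤ → ℝ) : Prop :=
  ∀ i, x (i + q) = x i + p

/-- The action of a configuration over one period. -/
noncomputable def action (e : StripA ≃ₜ StripA) (q : ℕ) (x : ℤ → ℝ) : ℝ :=
  ∑ i ∈ Finset.range q, genFun e (x i) (x (i + 1))

/-- Configurations minimizing the action among periodic configurations of type `(p, q)`. -/
def IsMinConf (e : StripA ≃ₜ StripA) (q : ℕ) (p : ℤ) (x : ℤ → ℝ) : Prop :=
  IsPeriodicConf q p x ∧ ∀ u, IsPeriodicConf q p u → action e q x ≤ action e q u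

theorem IsPeriodicConf.add_mul {q : ℕ} {p : ℤ} {x : ℤ → ℝ} (hx : IsPeriodicConf q p x)
    (i k : ℤ) : x (i + q * k) = x i + p * k := by
  induction k with
  | zero => simp
  | succ n ih =>
    have := hx (i + q * n)
    rw [ih] at this
    rw [show i + (q : ℤ) * (n + 1) = i + q * n + q by ring, this]
    push_cast
    ring
  | pred n ih =>
    have := hx (i + q * (-n - 1))
    have h2 : i + (q : ℤ) * (-n - 1) + q = i + q * -n := by ring
    rw [h2, ih] at this
    push_cast at this ⊢
    linarith

theorem IsPeriodicConf.shift {q : ℕ} {p : ℤ} {x : ℤ → ℝ} (hx : IsPeriodicConf q p x) (a : ℤ)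
    (b : ℝ) : IsPeriodicConf q p fun i => x (i + a) + b := fun i => by
  change x (i + q + a) + b = x (i + a) + b + p
  rw [show i + (q : ℤ) + a = i + a + q by ring, hx]
  ring

namespace IsAreaTwist

variable {e : StripA ≃ₜ StripA} (he : IsAreaTwist e) {q : ℕ} {p : ℤ}

include he

theorem action_add_int (x : ℤ → ℝ) (b : ℤ) :
    action e q (fun i => x i + b) = action e q x :=
  Finset.sum_congr rfl fun _ _ => he.genFun_add_int b _ _

theorem action_shift_one {x : ℤ → ℝ} (hx : IsPeriodicConf q p x) :
    action e q (fun i => x (i + 1)) = action e q x := by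
  have h1 := Finset.sum_range_succ (fun i : ℕ => genFun e (x i) (x (i + 1))) q
  have h2 := Finset.sum_range_succ' (fun i : ℕ => genFun e (x i) (x (i + 1))) q
  have h3 : genFun e (x q) (x (q + 1)) = genFun e (x 0) (x 1) := by
    have h4 := hx 0
    have h5 := hx 1
    rw [zero_add] at h4
    rw [add_comm] at h5
    rw [h4, h5, he.genFun_add_int]
  simp only [action]
  push_cast at h1 h2
  rw [h3] at h1
  linarith

theorem action_shift {x : ℤ → ℝ} (hx : IsPeriodicConf q p x) (a : ℤ) :
    action e q (fun i => x (i + a)) = action e q x := by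
  have hs : ∀ a, IsPeriodicConf q p fun i => x (i + a) := fun a => by
    simpa using hx.shift a 0
  have hstep : ∀ a, action e q (fun i => x (i + (a + 1))) = action e q fun i => x (i + a) := by
    intro a
    rw [← he.action_shift_one (hs a)]
    congr 1
    funext i
    congr 1
    ring
  induction a with
  | zero => simp
  | succ n ih => rw [hstep, ih]
  | pred n ih =>
    have := hstep (-n - 1)
    rw [sub_add_cancel, ih] at this
    exact this.symm

theorem isMinConf_shift {x : ℤ → ℝ} (hx : IsMinConf e q p x) (a b : ℤ) :
    IsMinConf e q p fun i => x (i + a) + b := by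
  refine ⟨hx.1.shift a b, fun u hu => ?_⟩
  rw [he.action_add_int (fun i => x (i + a)) b, he.action_shift hx.1]
  exact hx.2 u hu

theorem isMinConf_min {x u : ℤ → ℝ} (hx : IsMinConf e q p x) (hu : IsMinConf e q p u) :
    IsMinConf e q p fun i => min (x i) (u i) := by
  have h1 : IsPeriodicConf q p fun i => min (x i) (u i) := fun i => by
    simp only [hx.1 i, hu.1 i, min_add_add_right]
  have h2 : IsPeriodicConf q p fun i => max (x i) (u i) := fun i => by
    simp only [hx.1 i, hu.1 i, max_add_add_right]
  have h3 : action e q (fun i => min (x i) (u i)) + action e q (fun i => max (x i) (u i)) ≤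
      action e q x + action e q u := by
    simp only [action, ← Finset.sum_add_distrib]
    exact Finset.sum_le_sum fun i _ => he.genFun_min_add_genFun_max _ _ _ _
  refine ⟨h1, fun v hv => ?_⟩
  have h4 := hu.2 _ h2
  have h5 := hx.2 v hv
  linarith

theorem continuous_action : Continuous (action e q) := by
  refine continuous_finsetSum _ fun i _ => ?_
  exact he.continuous_genFun.comp (show Continuous fun x : ℤ → ℝ => (x i, x (i + 1)) from
    (continuous_apply _).prodMk (continuous_apply _))

/-- Configurations of bounded action have bounded increments. -/
theorem exists_increment_bound (hq : 0 < q) (p : ℤ) (B : ℝ) : ∃ E : ℝ, 0 ≤ E ∧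
    ∀ x, IsPeriodicConf q p x → action e q x ≤ B → ∀ i, |x (i + 1) - x i| ≤ E := by
  obtain ⟨C, hC⟩ := he.exists_le_genFun
  set D := |B + C| with hD
  have hD0 : 0 ≤ D := abs_nonneg _
  refine ⟨D + |(p : ℝ)| + q * D, by positivity, fun x hx hB => ?_⟩
  have hup : ∀ i, x (i + 1) - x i ≤ D := by
    intro i
    have hq' : (q : ℤ) ≠ 0 := by omega
    obtain ⟨r, hr⟩ := Int.eq_ofNat_of_zero_le (Int.emod_nonneg i hq')
    have hrq : r < q := by
      have := Int.emod_lt_of_pos i (show (0 : ℤ) < q by omega)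
      omega
    have h1 := Finset.single_le_sum (f := fun i : ℕ => genFun e (x i) (x (i + 1)))
      (fun i _ => measureReal_nonneg) (Finset.mem_range.2 hrq)
    have h2 := hC (x r) (x (r + 1))
    have h3 : i = r + q * (i / q) := by
      have := Int.emod_add_mul_ediv i q
      rw [hr] at this
      exact this.symm
    have h4 := hx.add_mul r (i / q)
    have h5 := hx.add_mul (r + 1) (i / q)
    rw [← h3] at h4
    rw [show (r : ℤ) + 1 + q * (i / q) = i + 1 by linarith] at h5
    have h6 : action e q x = ∑ i ∈ Finset.range q, genFun e (x i) (x (i + 1)) := rfl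
    have h7 := le_abs_self (B + C)
    linarith
  have hsum : ∀ (n : ℕ) i, x (i + n) ≤ x i + n * D := by
    intro n i
    induction n with
    | zero => simp
    | succ n ih =>
      have := hup (i + n)
      push_cast
      rw [← add_assoc]
      linarith
  intro i
  obtain ⟨n, rfl⟩ : ∃ n, q = n + 1 := ⟨q - 1, by omega⟩
  have h1 := hsum n (i + 1)
  have h2 := hx i
  rw [show i + ((n + 1 : ℕ) : ℤ) = i + 1 + n by push_cast; ring] at h2
  have h3 := hup i
  have h4 := neg_abs_le (p : ℝ)
  have h5 := abs_nonneg (p : ℝ)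
  rw [abs_le]
  push_cast
  have h6 : 0 ≤ (n : ℝ) * D := by positivity
  constructor <;> linarith

theorem exists_isMinConf (hq : 0 < q) (p : ℤ) :
    ∃ x, IsMinConf e q p x ∧ x 0 ∈ Icc (0 : ℝ) 1 := by
  set x₀ : ℤ → ℝ := fun i => i * (p / q) with hx₀
  have hx₀p : IsPeriodicConf q p x₀ := fun i => by
    have : (q : ℝ) ≠ 0 := by positivity
    simp only [hx₀]
    push_cast
    field_simp
  obtain ⟨E, hE0, hE⟩ := he.exists_increment_bound hq p (action e q x₀)
  let K : Set (ℤ → ℝ) :=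
    {x | IsPeriodicConf q p x ∧ x 0 ∈ Icc (0 : ℝ) 1 ∧ ∀ i, |x (i + 1) - x i| ≤ E}
  have hKclosed : IsClosed K := by
    refine IsClosed.inter ?_ (IsClosed.inter ?_ ?_)
    · change IsClosed {x : ℤ → ℝ | ∀ i, x (i + q) = x i + p}
      simp only [ofPred_forall]
      exact isClosed_iInter fun i => isClosed_eq (by fun_prop) (by fun_prop)
    · exact isClosed_Icc.preimage (continuous_apply 0)
    · change IsClosed {x : ℤ → ℝ | ∀ i, |x (i + 1) - x i| ≤ E}
      simp only [ofPred_forall]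
      exact isClosed_iInter fun i => isClosed_le (by fun_prop) (by fun_prop)
  have hKsub : K ⊆ pi univ fun i : ℤ => Icc (-(1 + |(i : ℝ)| * E)) (1 + |(i : ℝ)| * E) := by
    rintro x ⟨-, h0, h1⟩ i -
    have h2 : ∀ n : ℕ, |x n - x 0| ≤ n * E ∧ |x (-n) - x 0| ≤ n * E := by
      intro n
      induction n with
      | zero => simp
      | succ n ih =>
        have h3 := abs_le.1 (h1 n)
        have h4 := abs_le.1 (h1 (-(n + 1)))
        rw [show -((n : ℤ) + 1) + 1 = -n by ring] at h4
        have h5 := abs_le.1 ih.1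
        have h6 := abs_le.1 ih.2
        push_cast
        constructor <;> rw [abs_le] <;> constructor <;> linarith
    have h3 : |x i - x 0| ≤ |(i : ℝ)| * E := by
      rcases Int.eq_nat_or_neg i with ⟨n, rfl | rfl⟩
      · simpa using (h2 n).1
      · simpa using (h2 n).2
    have h4 := abs_le.1 h3
    exact ⟨by linarith [h0.1], by linarith [h0.2]⟩
  have hK : IsCompact K :=
    (isCompact_univ_pi fun i => isCompact_Icc).of_isClosed_subset hKclosed hKsub
  have hx₀K : x₀ ∈ K := ⟨hx₀p, by simp [hx₀], hE x₀ hx₀p le_rfl⟩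
  obtain ⟨x, hxK, hx⟩ := hK.exists_isMinOn ⟨x₀, hx₀K⟩ he.continuous_action.continuousOn
  refine ⟨x, ⟨hxK.1, fun u hu => ?_⟩, hxK.2.1⟩
  rcases le_total (action e q u) (action e q x₀) with h | h
  · have h1 : (fun i => u i + ((-⌊u 0⌋ : ℤ) : ℝ)) ∈ K := by
      refine ⟨by simpa using hu.shift 0 ((-⌊u 0⌋ : ℤ) : ℝ), ?_, fun i => ?_⟩
      · push_cast
        exact ⟨by linarith [Int.floor_le (u 0)], by linarith [Int.lt_floor_add_one (u 0)]⟩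
      · simpa using hE u hu h i
    have h2 := hx h1
    rwa [mem_ofPred_eq, he.action_add_int] at h2
  · exact (hx hx₀K).trans h

theorem isMinConf_critical_zero (hq : 2 ≤ q) {x : ℤ → ℝ} (hx : IsMinConf e q p x) :
    heightIn e (x 0) (x 1) = heightOut e (x 1) (x 2) := by
  let u : ℝ → ℤ → ℝ := fun s i => if (q : ℤ) ∣ i - 1 then x i + (s - x 1) else x i
  have hu : ∀ s, IsPeriodicConf q p (u s) := by
    intro s i
    have h1 : (q : ℤ) ∣ i + q - 1 ↔ (q : ℤ) ∣ i - 1 := by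
      rw [show i + (q : ℤ) - 1 = i - 1 + q by ring, dvd_add_self_right]
    simp only [u, h1, hx.1 i]
    split_ifs <;> ring
  have hu1 : ∀ s, u s 1 = s := fun s => by simp [u]
  have hne : ∀ s (i : ℤ), 2 ≤ i → i ≤ q → u s i = x i := by
    intro s i h2 hi
    refine if_neg fun hd => ?_
    have := Int.le_of_dvd (by omega) hd
    omega
  have hu0 : ∀ s, u s 0 = x 0 := by
    intro s
    refine if_neg fun hd => ?_
    rw [zero_sub, dvd_neg] at hd
    have := Int.le_of_dvd (by omega) hd
    omega
  obtain ⟨n, rfl⟩ : ∃ n, q = n + 2 := ⟨q - 2, by omega⟩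
  set R := ∑ i ∈ Finset.range n, genFun e (x (i + 2)) (x (i + 3)) with hR
  have hact : ∀ s, action e (n + 2) (u s) = R + genFun e s (x 2) + genFun e (x 0) s := by
    intro s
    rw [action, Finset.sum_range_succ', Finset.sum_range_succ']
    push_cast
    rw [hu1, hu0, hne s 2 le_rfl (by push_cast; omega)]
    congr 2
    refine Finset.sum_congr rfl fun i hi => ?_
    have := Finset.mem_range.1 hi
    rw [show (i : ℤ) + 1 + 1 = i + 2 by ring, show (i : ℤ) + 2 + 1 = i + 3 by ring,
      hne s _ (by omega) (by push_cast; omega), hne s _ (by omega) (by push_cast; omega)]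
  have hux : u (x 1) = x := by
    funext i
    simp [u]
  have hmin : IsLocalMin (fun s => R + genFun e s (x 2) + genFun e (x 0) s) (x 1) :=
    Eventually.of_forall fun s => by
      change R + genFun e (x 1) (x 2) + genFun e (x 0) (x 1) ≤
        R + genFun e s (x 2) + genFun e (x 0) s
      rw [← hact, ← hact, hux]
      exact hx.2 _ (hu s)
  have hd := ((he.hasDerivAt_genFun_fst (x 1) (x 2)).const_add R).add
    (he.hasDerivAt_genFun_snd (x 0) (x 1))
  have := hmin.hasDerivAt_eq_zero hd
  linarith

theorem isMinConf_critical (hq : 2 ≤ q) {x : ℤ → ℝ} (hx : IsMinConf e q p x) (i : ℤ) :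
    heightIn e (x i) (x (i + 1)) = heightOut e (x (i + 1)) (x (i + 2)) := by
  have h := he.isMinConf_critical_zero hq (he.isMinConf_shift hx i 0)
  simp only [Int.cast_zero, add_zero, zero_add] at h
  rwa [add_comm 1 i, add_comm 2 i] at h

theorem iterate_one_lt {y : ℕ → ℝ}
    (hy : ∀ j, heightIn e (y j) (y (j + 1)) = heightOut e (y (j + 1)) (y (j + 2)))
    (h0 : (e (y 0, (1 : unitInterval))).1 < y 1) (n : ℕ) :
    (fun s : ℝ => (e (s, (1 : unitInterval))).1)^[n + 1] (y 0) < y (n + 1) := by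
  suffices h : heightIn e (y n) (y (n + 1)) = 1 ∧
      (fun s : ℝ => (e (s, (1 : unitInterval))).1)^[n + 1] (y 0) < y (n + 1) from h.2
  induction n with
  | zero => exact ⟨(he.height_of_gt h0).2, h0⟩
  | succ n ih =>
    have h1 : heightIn e (y (n + 1)) (y (n + 2)) = 1 ∧
        (e (y (n + 1), (1 : unitInterval))).1 ≤ y (n + 2) := by
      have h2 := hy n
      rw [ih.1] at h2
      rcases trichotomy (e := e) (y (n + 1)) (y (n + 2)) with h | ⟨t, ht⟩ | h
      · rw [(he.height_of_lt h).1] at h2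
        exact absurd h2 one_ne_zero
      · rw [he.heightOut_of_apply_eq ht] at h2
        have ht1 : t = 1 := Subtype.ext h2.symm
        subst ht1
        refine ⟨?_, ht.le⟩
        rw [he.heightIn_of_apply_eq ht, he.map_one]
        rfl
      · exact ⟨(he.height_of_gt h).2, h.le⟩
    refine ⟨h1.1, ?_⟩
    rw [Function.iterate_succ_apply']
    exact (he.strictMono_one ih.2).trans_le h1.2

theorem lt_iterate_zero {y : ℕ → ℝ}
    (hy : ∀ j, heightIn e (y j) (y (j + 1)) = heightOut e (y (j + 1)) (y (j + 2)))
    (h0 : y 1 < (e (y 0, (0 : unitInterval))).1) (n : ℕ) :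
    y (n + 1) < (fun s : ℝ => (e (s, (0 : unitInterval))).1)^[n + 1] (y 0) := by
  suffices h : heightIn e (y n) (y (n + 1)) = 0 ∧
      y (n + 1) < (fun s : ℝ => (e (s, (0 : unitInterval))).1)^[n + 1] (y 0) from h.2
  induction n with
  | zero => exact ⟨(he.height_of_lt h0).2, h0⟩
  | succ n ih =>
    have h1 : heightIn e (y (n + 1)) (y (n + 2)) = 0 ∧
        y (n + 2) ≤ (e (y (n + 1), (0 : unitInterval))).1 := by
      have h2 := hy n
      rw [ih.1] at h2
      rcases trichotomy (e := e) (y (n + 1)) (y (n + 2)) with h | ⟨t, ht⟩ | h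
      · exact ⟨(he.height_of_lt h).2, h.le⟩
      · rw [he.heightOut_of_apply_eq ht] at h2
        have ht1 : t = 0 := Subtype.ext h2.symm
        subst ht1
        refine ⟨?_, ht.ge⟩
        rw [he.heightIn_of_apply_eq ht, he.map_zero]
        rfl
      · rw [(he.height_of_gt h).1] at h2
        exact absurd h2 zero_ne_one
    refine ⟨h1.1, ?_⟩
    rw [Function.iterate_succ_apply']
    exact h1.2.trans_lt (he.strictMono_zero ih.2)

/-- A minimizing configuration whose rotation number lies between those of the boundary circles
is the sequence of abscissas of an orbit. -/
theorem exists_orbit_of_isMinConf (hq : 2 ≤ q)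
    (hzero : ∀ s : ℝ, (fun s : ℝ => (e (s, (0 : unitInterval))).1)^[q] s ≤ s + p)
    (hone : ∀ s : ℝ, s + p ≤ (fun s : ℝ => (e (s, (1 : unitInterval))).1)^[q] s)
    {x : ℤ → ℝ} (hx : IsMinConf e q p x) :
    ∃ z : ℤ → StripA, (∀ i, (z i).1 = x i) ∧ ∀ i, e (z i) = z (i + 1) := by
  have hcrit := he.isMinConf_critical hq hx
  obtain ⟨m, hm⟩ : ∃ m, q = m + 1 := ⟨q - 1, by omega⟩
  have hdom : ∀ i, ∃ t, (e (x i, t)).1 = x (i + 1) := by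
    intro i
    have hy : ∀ j : ℕ, heightIn e (x (i + j)) (x (i + (j + 1 : ℕ))) =
        heightOut e (x (i + (j + 1 : ℕ))) (x (i + (j + 2 : ℕ))) := by
      intro j
      have := hcrit (i + j)
      push_cast
      rwa [← add_assoc, ← add_assoc]
    have hend := hx.1 i
    rw [hm] at hend
    rcases trichotomy (e := e) (x i) (x (i + 1)) with h | h | h
    · exfalso
      have h1 := he.lt_iterate_zero (y := fun j : ℕ => x (i + j)) hy (by simpa using h) m
      have h2 := hzero (x i)
      rw [hm] at h2
      simp only [Nat.cast_zero, add_zero, hend] at h1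
      exact absurd h2 (not_le.2 h1)
    · exact h
    · exfalso
      have h1 := he.iterate_one_lt (y := fun j : ℕ => x (i + j)) hy (by simpa using h) m
      have h2 := hone (x i)
      rw [hm] at h2
      simp only [Nat.cast_zero, add_zero, hend] at h1
      exact absurd h2 (not_le.2 h1)
  choose t ht using hdom
  refine ⟨fun i => (x i, t i), fun i => rfl, fun i => Prod.ext (ht i) (Subtype.ext ?_)⟩
  rw [← he.heightIn_of_apply_eq (ht i), hcrit i]
  have h := ht (i + 1)
  rw [show i + 1 + 1 = i + 2 by ring] at h
  exact he.heightOut_of_apply_eq h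

theorem isMinConf_lt_succ (hq : 2 ≤ q)
    (hzero : ∀ s : ℝ, (fun s : ℝ => (e (s, (0 : unitInterval))).1)^[q] s ≤ s + p)
    (hone : ∀ s : ℝ, s + p ≤ (fun s : ℝ => (e (s, (1 : unitInterval))).1)^[q] s)
    {x u : ℤ → ℝ} (hx : IsMinConf e q p x) (hu : IsMinConf e q p u) {i : ℤ} (hi : x i < u i) :
    x (i + 1) < u (i + 1) := by
  by_contra hlt
  rw [not_lt] at hlt
  obtain ⟨zu, hzu, hzu'⟩ := he.exists_orbit_of_isMinConf hq hzero hone hu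
  obtain ⟨zm, hzm, hzm'⟩ := he.exists_orbit_of_isMinConf hq hzero hone (he.isMinConf_min hx hu)
  have hm1 : (zm (i + 1)).1 = u (i + 1) := by rw [hzm, min_eq_right hlt]
  have h1 : ((u (i + 1), (zm (i + 1)).2) : StripA) = zm (i + 1) := Prod.ext hm1.symm rfl
  have h2 : ((u (i + 1), (zu (i + 1)).2) : StripA) = zu (i + 1) := Prod.ext (hzu _).symm rfl
  have h3 : e.symm (zm (i + 1)) = zm i := by rw [← hzm', Homeomorph.symm_apply_apply]
  have h4 : e.symm (zu (i + 1)) = zu i := by rw [← hzu', Homeomorph.symm_apply_apply]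
  have h5 : (zu (i + 1)).2 < (zm (i + 1)).2 := by
    apply ((he.symm_twist (u (i + 1))).lt_iff_gt).1
    simp only [h1, h2, h3, h4]
    rw [hzm, hzu, min_eq_left hi.le]
    exact hi
  have h6 := he.twist (u (i + 1)) h5
  simp only [h1, h2, hzm', hzu', hzm, hzu] at h6
  exact absurd h6 (not_lt.2 (min_le_right _ _))

/-- Minimizing configurations are totally ordered. -/
theorem isMinConf_total (hq : 2 ≤ q)
    (hzero : ∀ s : ℝ, (fun s : ℝ => (e (s, (0 : unitInterval))).1)^[q] s ≤ s + p)
    (hone : ∀ s : ℝ, s + p ≤ (fun s : ℝ => (e (s, (1 : unitInterval))).1)^[q] s)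
    {x u : ℤ → ℝ} (hx : IsMinConf e q p x) (hu : IsMinConf e q p u) :
    (∀ i, x i ≤ u i) ∨ ∀ i, u i ≤ x i := by
  have key : ∀ {x u : ℤ → ℝ}, IsMinConf e q p x → IsMinConf e q p u → ∀ i, x i < u i →
      ∀ j, x j ≤ u j := by
    intro x u hx hu i hi j
    have h1 : ∀ n : ℕ, x (i + n) < u (i + n) := by
      intro n
      induction n with
      | zero => simpa using hi
      | succ n ih =>
        have := he.isMinConf_lt_succ hq hzero hone hx hu ih
        push_cast
        rwa [← add_assoc]
    obtain ⟨n, hn⟩ := Int.eq_ofNat_of_zero_le (show 0 ≤ j + q * |i - j| - i by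
      have h2 : |i - j| ≤ q * |i - j| := le_mul_of_one_le_left (abs_nonneg _) (by omega)
      have h3 := le_abs_self (i - j)
      linarith)
    have h4 := h1 n
    rw [show i + (n : ℤ) = j + q * |i - j| by
      rw [← hn]
      ring, hx.1.add_mul, hu.1.add_mul] at h4
    linarith
  by_cases h : ∃ i, x i < u i
  · obtain ⟨i, hi⟩ := h
    exact Or.inl (key hx hu i hi)
  · push Not at h
    exact Or.inr h

end IsAreaTwist

/-- The iterate `e^k`, `k ∈ ℤ`, of a homeomorphism of the strip. -/
def stripIter (e : StripA ≃ₜ StripA) (k : ℤ) (z : StripA) : StripA :=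
  ((e.toEquiv : Equiv.Perm StripA) ^ k) z

section stripIter

variable (e : StripA ≃ₜ StripA)

theorem stripIter_zero (z : StripA) : stripIter e 0 z = z := rfl

theorem stripIter_add (k l : ℤ) (z : StripA) :
    stripIter e (k + l) z = stripIter e k (stripIter e l z) := by
  simp only [stripIter, zpow_add, Equiv.Perm.mul_apply]

theorem stripIter_one (z : StripA) : stripIter e 1 z = e z := by
  simp [stripIter]

theorem stripIter_neg_one (z : StripA) : stripIter e (-1) z = e.symm z := by
  simp only [stripIter, zpow_neg, zpow_one]
  rfl

theorem stripIter_add_one (k : ℤ) (z : StripA) : stripIter e (k + 1) z = e (stripIter e k z) := by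
  rw [add_comm, stripIter_add, stripIter_one]

theorem stripIter_sub_one (k : ℤ) (z : StripA) :
    stripIter e (k - 1) z = e.symm (stripIter e k z) := by
  rw [sub_eq_add_neg, add_comm, stripIter_add, stripIter_neg_one]

theorem continuous_stripIter (k : ℤ) : Continuous (stripIter e k) := by
  induction k with
  | zero => exact continuous_id
  | succ n ih => exact (e.continuous.comp ih).congr fun z => (stripIter_add_one e n z).symm
  | pred n ih => exact (e.symm.continuous.comp ih).congr fun z => (stripIter_sub_one e (-n) z).symm

theorem stripIter_eq_of_orbit {z : ℤ → StripA} (hz : ∀ i, e (z i) = z (i + 1)) (k l : ℤ) :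
    stripIter e k (z l) = z (k + l) := by
  induction k with
  | zero => rw [zero_add, stripIter_zero]
  | succ n ih => rw [stripIter_add_one, ih, hz]; congr 1; ring
  | pred n ih =>
    rw [stripIter_sub_one, ih, Homeomorph.symm_apply_eq, hz]
    congr 1
    ring

end stripIter

theorem continuous_deckZ (n : ℤ) : Continuous (deckZ n) := by
  unfold deckZ
  fun_prop

/-- Two points are comparable if their orbits are ordered horizontally. -/
def Comparable (e : StripA ≃ₜ StripA) (z w : StripA) : Prop :=
  (∀ k, (stripIter e k z).1 ≤ (stripIter e k w).1) ∨
    ∀ k, (stripIter e k w).1 ≤ (stripIter e k z).1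

theorem isClosed_comparable (e : StripA ≃ₜ StripA) :
    IsClosed {v : StripA × StripA | Comparable e v.1 v.2} := by
  refine IsClosed.union ?_ ?_
  · change IsClosed {v : StripA × StripA | ∀ k, (stripIter e k v.1).1 ≤ (stripIter e k v.2).1}
    simp only [ofPred_forall]
    exact isClosed_iInter fun k => isClosed_le
      (continuous_fst.comp ((continuous_stripIter e k).comp continuous_fst))
      (continuous_fst.comp ((continuous_stripIter e k).comp continuous_snd))
  · change IsClosed {v : StripA × StripA | ∀ k, (stripIter e k v.2).1 ≤ (stripIter e k v.1).1}
    simp only [ofPred_forall]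
    exact isClosed_iInter fun k => isClosed_le
      (continuous_fst.comp ((continuous_stripIter e k).comp continuous_snd))
      (continuous_fst.comp ((continuous_stripIter e k).comp continuous_fst))

/-- A set of pairwise comparable points, invariant under the dynamics and deck translations. -/
structure IsOrderedSet (e : StripA ≃ₜ StripA) (S : Set StripA) : Prop where
  deck : ∀ n, ∀ z ∈ S, deckZ n z ∈ S
  iter : ∀ k, ∀ z ∈ S, stripIter e k z ∈ S
  comparable : ∀ z ∈ S, ∀ w ∈ S, Comparable e z w

theorem IsOrderedSet.closure {e : StripA ≃ₜ StripA} {S : Set StripA} (hS : IsOrderedSet e S) :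
    IsOrderedSet e (closure S) where
  deck n _ hz := map_mem_closure (continuous_deckZ n) hz (hS.deck n)
  iter k _ hz := map_mem_closure (continuous_stripIter e k) hz (hS.iter k)
  comparable z hz w hw := by
    have h : (z, w) ∈ _root_.closure (S ×ˢ S) := by
      rw [closure_prod_eq]
      exact ⟨hz, hw⟩
    exact closure_minimal (fun v hv => hS.comparable v.1 hv.1 v.2 hv.2) (isClosed_comparable e) h

/-- The set of translates of the points of the orbit of `z`. -/
def orbitSet (e : StripA ≃ₜ StripA) (z : StripA) : Set StripA :=
  {w | ∃ n k : ℤ, w = deckZ n (stripIter e k z)}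

/-- Horizontal displacements inequalities persisting along all multiples of `k` bound `k * ρ`. -/
def HasOrderedRotation (e : StripA ≃ₜ StripA) (S : Set StripA) (ρ : ℝ) : Prop :=
  ∀ z ∈ S, ∀ (k : ℕ) (m : ℤ),
    ((∀ n : ℕ, z.1 + n * m ≤ (stripIter e (n * k) z).1) → m ≤ k * ρ) ∧
      ((∀ n : ℕ, (stripIter e (n * k) z).1 ≤ z.1 + n * m) → k * ρ ≤ m)

theorem hasOrderedRotation_of_tendsto {e : StripA ≃ₜ StripA} {S : Set StripA} {ρ : ℝ}
    (h : ∀ z ∈ S, Tendsto (fun n : ℕ => ((stripIter e n z).1 - z.1) / n) atTop (𝓝 ρ)) :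
    HasOrderedRotation e S ρ := by
  intro z hz k m
  rcases Nat.eq_zero_or_pos k with rfl | hk
  · constructor <;> intro hn <;> simpa [stripIter_zero] using hn 1
  have hk' : (0 : ℝ) < k := by exact_mod_cast hk
  have ht := (h z hz).comp (tendsto_id.atTop_mul_const' hk)
  constructor <;> intro hn
  · have : (m : ℝ) / k ≤ ρ := by
      refine ge_of_tendsto ht ?_
      filter_upwards [eventually_gt_atTop 0] with n hn0
      have hn' : (0 : ℝ) < n := by exact_mod_cast hn0
      have := hn n
      simp only [Function.comp, id]
      push_cast
      rw [div_le_div_iff₀ hk' (by positivity)]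
      nlinarith
    rwa [div_le_iff₀ hk', mul_comm] at this
  · have : ρ ≤ (m : ℝ) / k := by
      refine le_of_tendsto ht ?_
      filter_upwards [eventually_gt_atTop 0] with n hn0
      have hn' : (0 : ℝ) < n := by exact_mod_cast hn0
      have := hn n
      simp only [Function.comp, id]
      push_cast
      rw [div_le_div_iff₀ (by positivity) hk']
      nlinarith
    rwa [le_div_iff₀ hk', mul_comm] at this

theorem hasOrderedRotation_of_abs_le {e : StripA ≃ₜ StripA} {S : Set StripA} {ρ C : ℝ}
    (h : ∀ z ∈ S, ∀ k, |(stripIter e k z).1 - z.1 - k * ρ| ≤ C) : HasOrderedRotation e S ρ := by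
  intro z hz k m
  constructor <;> intro hn
  · by_contra! hlt
    obtain ⟨n, hnC⟩ := exists_nat_gt (C / (m - k * ρ))
    rw [div_lt_iff₀ (by linarith)] at hnC
    have h1 := (abs_le.1 (h z hz (n * k))).2
    have h2 := hn n
    push_cast at h1
    nlinarith
  · by_contra! hlt
    obtain ⟨n, hnC⟩ := exists_nat_gt (C / (k * ρ - m))
    rw [div_lt_iff₀ (by linarith)] at hnC
    have h1 := (abs_le.1 (h z hz (n * k))).1
    have h2 := hn n
    push_cast at h1
    nlinarith

namespace IsAreaTwist

variable {e : StripA ≃ₜ StripA} (he : IsAreaTwist e)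

include he

theorem stripIter_deckZ (k n : ℤ) (z : StripA) :
    stripIter e k (deckZ n z) = deckZ n (stripIter e k z) := by
  induction k with
  | zero => rfl
  | succ m ih => rw [stripIter_add_one, ih, he.map_deckZ, stripIter_add_one]
  | pred m ih => rw [stripIter_sub_one, ih, he.symm_map_deckZ, stripIter_sub_one]

theorem eq_of_forall_le {z w : StripA} (h : ∀ k, (stripIter e k z).1 ≤ (stripIter e k w).1)
    (hzw : z.1 = w.1) : z = w := by
  obtain ⟨x, s⟩ := z
  obtain ⟨x', t⟩ := w
  obtain rfl : x = x' := hzw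
  have h1 := h 1
  have h2 := h (-1)
  rw [stripIter_one, stripIter_one] at h1
  rw [stripIter_neg_one, stripIter_neg_one] at h2
  have h3 : s ≤ t := (he.twist x).le_iff_le.1 h1
  have h4 : t ≤ s := (he.symm_twist x).le_iff_ge.1 h2
  rw [le_antisymm h3 h4]

theorem eq_of_comparable {z w : StripA} (h : Comparable e z w) (hzw : z.1 = w.1) : z = w := by
  rcases h with h | h
  · exact he.eq_of_forall_le h hzw
  · exact (he.eq_of_forall_le h hzw.symm).symm

theorem stripIter_le {z w : StripA} (h : Comparable e z w) (hzw : z.1 ≤ w.1) (k : ℤ) :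
    (stripIter e k z).1 ≤ (stripIter e k w).1 := by
  rcases h with h | h
  · exact h k
  · rw [he.eq_of_forall_le h (le_antisymm (h 0) hzw)]

theorem apply_lt {S : Set StripA} (hS : IsOrderedSet e S) {z w : StripA} (hz : z ∈ S)
    (hw : w ∈ S) (hzw : z.1 < w.1) : (e z).1 < (e w).1 := by
  have h1 := hS.iter 1 z hz
  have h2 := hS.iter 1 w hw
  rw [stripIter_one] at h1 h2
  have h3 := he.stripIter_le (hS.comparable z hz w hw) hzw.le 1
  rw [stripIter_one, stripIter_one] at h3
  refine h3.lt_of_ne fun h => ?_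
  have := e.injective (he.eq_of_comparable (hS.comparable _ h1 _ h2) h)
  rw [this] at hzw
  exact lt_irrefl _ hzw

section Rotation

variable {S : Set StripA} (hS : IsOrderedSet e S)

include hS

theorem add_mul_le_stripIter {z : StripA} (hz : z ∈ S) {k m : ℤ}
    (h : z.1 + m ≤ (stripIter e k z).1) (n : ℕ) : z.1 + n * m ≤ (stripIter e (n * k) z).1 := by
  induction n with
  | zero => simp [stripIter_zero]
  | succ n ih =>
    have h1 : (deckZ (n * m) z).1 ≤ (stripIter e (n * k) z).1 := by
      simpa [deckZ] using ih
    have h2 := he.stripIter_le (hS.comparable _ (hS.deck _ z hz) _ (hS.iter _ z hz)) h1 k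
    rw [he.stripIter_deckZ, ← stripIter_add] at h2
    have h3 : ((n + 1 : ℕ) : ℤ) * k = k + n * k := by push_cast; ring
    rw [h3]
    refine le_trans ?_ h2
    simp only [deckZ]
    push_cast
    linarith

theorem stripIter_le_add_mul {z : StripA} (hz : z ∈ S) {k m : ℤ}
    (h : (stripIter e k z).1 ≤ z.1 + m) (n : ℕ) : (stripIter e (n * k) z).1 ≤ z.1 + n * m := by
  induction n with
  | zero => simp [stripIter_zero]
  | succ n ih =>
    have h1 : (stripIter e (n * k) z).1 ≤ (deckZ (n * m) z).1 := by
      simpa [deckZ] using ih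
    have h2 := he.stripIter_le (hS.comparable _ (hS.iter _ z hz) _ (hS.deck _ z hz)) h1 k
    rw [he.stripIter_deckZ, ← stripIter_add] at h2
    have h3 : ((n + 1 : ℕ) : ℤ) * k = k + n * k := by push_cast; ring
    rw [h3]
    refine h2.trans ?_
    simp only [deckZ]
    push_cast
    linarith

theorem abs_displacement_lt {ρ : ℝ} (hρ : HasOrderedRotation e S ρ) {z : StripA} (hz : z ∈ S)
    (k : ℤ) : |(stripIter e k z).1 - z.1 - k * ρ| < 1 := by
  have key : ∀ z ∈ S, ∀ k : ℕ, |(stripIter e k z).1 - z.1 - k * ρ| < 1 := by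
    intro z hz k
    set d := (stripIter e k z).1 - z.1 with hd
    have h1 := (hρ z hz k ⌊d⌋).1 (he.add_mul_le_stripIter hS hz (by linarith [Int.floor_le d]))
    have h2 := (hρ z hz k ⌈d⌉).2 (he.stripIter_le_add_mul hS hz (by linarith [Int.le_ceil d]))
    rw [abs_lt]
    constructor <;> linarith [Int.lt_floor_add_one d, Int.ceil_lt_add_one d]
  rcases Int.eq_nat_or_neg k with ⟨n, rfl | rfl⟩
  · exact_mod_cast key z hz n
  · have h := key _ (hS.iter (-n) z hz) n
    rw [← stripIter_add, add_neg_cancel, stripIter_zero, ← abs_neg] at h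
    convert h using 2
    push_cast
    ring

end Rotation

/-- An invariant horizontal line on which the map is increasing is an ordered set. -/
theorem isOrderedSet_line {c : unitInterval} (hc : ∀ x, (e (x, c)).2 = c)
    (hmono : StrictMono fun x : ℝ => (e (x, c)).1) : IsOrderedSet e {z | z.2 = c} := by
  have hsurj : Function.Surjective fun x : ℝ => (e (x, c)).1 := by
    refine surjective_of_continuous_of_add_one (by fun_prop) fun x => ?_
    have := he.map_deckZ 1 (x, c)
    simpa [deckZ] using congrArg Prod.fst this
  have hsymm : ∀ z : StripA, z.2 = c → (e.symm z).2 = c := by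
    rintro ⟨y, _⟩ rfl
    obtain ⟨x, hx⟩ := hsurj y
    rw [show ((y, _) : StripA) = e (x, _) from Prod.ext hx.symm (hc x).symm,
      Homeomorph.symm_apply_apply]
    exact (hc x).symm
  have hap : ∀ z : StripA, z.2 = c → (e z).2 = c := by
    rintro ⟨y, _⟩ rfl
    exact hc y
  have hiter : ∀ k, ∀ z ∈ {z : StripA | z.2 = c}, stripIter e k z ∈ {z : StripA | z.2 = c} := by
    intro k z hz
    induction k with
    | zero => exact hz
    | succ n ih => rw [stripIter_add_one]; exact hap _ ih
    | pred n ih => rw [stripIter_sub_one]; exact hsymm _ ih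
  have hle : ∀ z w : StripA, z.2 = c → w.2 = c → ((e z).1 ≤ (e w).1 ↔ z.1 ≤ w.1) := by
    rintro ⟨x, _⟩ ⟨y, _⟩ rfl rfl
    exact hmono.le_iff_le
  have hcomp : ∀ z w : StripA, z.2 = c → w.2 = c → z.1 ≤ w.1 →
      ∀ k, (stripIter e k z).1 ≤ (stripIter e k w).1 := by
    intro z w hz hw hzw k
    induction k with
    | zero => exact hzw
    | succ n ih =>
      rw [stripIter_add_one, stripIter_add_one]
      exact (hle _ _ (hiter _ z hz) (hiter _ w hw)).2 ih
    | pred n ih =>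
      rw [← hle _ _ (hiter _ z hz) (hiter _ w hw), ← stripIter_add_one, ← stripIter_add_one,
        sub_add_cancel]
      exact ih
  refine ⟨fun n z hz => hz, hiter, fun z hz w hw => ?_⟩
  exact (le_total z.1 w.1).imp (hcomp z w hz hw) (hcomp w z hw hz)

omit he in
theorem stripIter_line {c : unitInterval} (hc : ∀ x, (e (x, c)).2 = c) (n : ℕ) (x : ℝ) :
    stripIter e n (x, c) = ((fun s : ℝ => (e (s, c)).1)^[n] x, c) := by
  induction n with
  | zero => rfl
  | succ n ih =>
    rw [Nat.cast_succ, stripIter_add_one, ih, Function.iterate_succ_apply']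
    exact Prod.ext rfl (hc _)

theorem isOrderedSet_zero : IsOrderedSet e {z | z.2 = 0} :=
  he.isOrderedSet_line he.map_zero he.strictMono_zero

theorem isOrderedSet_one : IsOrderedSet e {z | z.2 = 1} :=
  he.isOrderedSet_line he.map_one he.strictMono_one

theorem isOrderedSet_orbitSet {z : StripA}
    (h : ∀ m k n l : ℤ, Comparable e (deckZ m (stripIter e k z)) (deckZ n (stripIter e l z))) :
    IsOrderedSet e (orbitSet e z) where
  deck n := by
    rintro _ ⟨m, k, rfl⟩
    exact ⟨n + m, k, (deckZ_add n m _).symm⟩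
  iter l := by
    rintro _ ⟨m, k, rfl⟩
    exact ⟨m, l + k, by rw [he.stripIter_deckZ, stripIter_add]⟩
  comparable := by
    rintro _ ⟨m, k, rfl⟩ _ ⟨n, l, rfl⟩
    exact h m k n l

/-- Birkhoff periodic orbits exist for every rational strictly between the rotation numbers of
the boundary circles. -/
theorem exists_birkhoff_orbit {ρ₀ ρ₁ : ℝ} (h0 : HasOrderedRotation e {z | z.2 = 0} ρ₀)
    (h1 : HasOrderedRotation e {z | z.2 = 1} ρ₁) {r : ℚ} (hr0 : ρ₀ < r) (hr1 : r < ρ₁) :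
    ∃ z : StripA, z.1 ∈ Icc (0 : ℝ) 1 ∧ IsOrderedSet e (orbitSet e z) ∧
      HasOrderedRotation e (orbitSet e z) r := by
  obtain ⟨q, p, hq, hpq⟩ : ∃ (q : ℕ) (p : ℤ), 2 ≤ q ∧ (q : ℝ) * r = p := by
    refine ⟨2 * r.den, 2 * r.num, by have := r.pos; omega, ?_⟩
    have h : ((r.den : ℚ) : ℝ) * r = ((r.num : ℚ) : ℝ) := by
      rw [← Rat.cast_mul, Rat.den_mul_eq_num]
    push_cast at h ⊢
    linarith
  have hq0 : (0 : ℝ) < q := by positivity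
  have hzero : ∀ s : ℝ, (fun s : ℝ => (e (s, (0 : unitInterval))).1)^[q] s ≤ s + p := by
    intro s
    by_contra! hlt
    have h2 := (h0 (s, 0) rfl q p).1 (he.add_mul_le_stripIter he.isOrderedSet_zero rfl
      (by rw [stripIter_line he.map_zero]; exact hlt.le))
    nlinarith
  have hone : ∀ s : ℝ, s + p ≤ (fun s : ℝ => (e (s, (1 : unitInterval))).1)^[q] s := by
    intro s
    by_contra! hlt
    have h2 := (h1 (s, 1) rfl q p).2 (he.stripIter_le_add_mul he.isOrderedSet_one rfl
      (by rw [stripIter_line he.map_one]; exact hlt.le))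
    nlinarith
  obtain ⟨x, hx, hx0⟩ := he.exists_isMinConf (show 0 < q by omega) p
  obtain ⟨z, hzx, hz⟩ := he.exists_orbit_of_isMinConf hq hzero hone hx
  have hfst : ∀ j n k : ℤ, (stripIter e j (deckZ n (stripIter e k (z 0)))).1 = x (j + k) + n := by
    intro j n k
    rw [he.stripIter_deckZ, ← stripIter_add, stripIter_eq_of_orbit e hz, add_zero, ← hzx]
    rfl
  refine ⟨z 0, by rwa [hzx], he.isOrderedSet_orbitSet fun m k n l => ?_, ?_⟩
  · simp only [Comparable, hfst]
    exact he.isMinConf_total hq hzero hone (he.isMinConf_shift hx k m) (he.isMinConf_shift hx l n)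
  · rintro _ ⟨m, l, rfl⟩ k n
    have hx1 : ((deckZ m (stripIter e l (z 0))).1 : ℝ) = x l + m := by
      simpa [stripIter_zero] using hfst 0 m l
    have hx2 := hx.1.add_mul l k
    rw [hx1]
    simp only [hfst]
    constructor <;> intro h
    · have h3 := h q
      rw [add_comm _ l, hx2] at h3
      push_cast at h3
      have h4 : (q : ℝ) * n ≤ q * (k * r) := by
        rw [mul_left_comm, hpq]
        linarith
      exact le_of_mul_le_mul_left h4 hq0
    · have h3 := h q
      rw [add_comm _ l, hx2] at h3
      push_cast at h3
      have h4 : (q : ℝ) * (k * r) ≤ q * n := by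
        rw [mul_left_comm, hpq]
        linarith
      exact le_of_mul_le_mul_left h4 hq0

theorem exists_isOrderedSet_of_lt {ρ₀ ρ₁ : ℝ} (h0 : HasOrderedRotation e {z | z.2 = 0} ρ₀)
    (h1 : HasOrderedRotation e {z | z.2 = 1} ρ₁) (hlt : ρ₀ < ρ₁) {ρ : ℝ} (hρ : ρ ∈ Icc ρ₀ ρ₁) :
    ∃ S : Set StripA, S.Nonempty ∧ IsClosed S ∧ IsOrderedSet e S ∧ HasOrderedRotation e S ρ := by
  let F : Set (StripA × ℝ) := {v |
    (∀ m k n l : ℤ, Comparable e (deckZ m (stripIter e k v.1)) (deckZ n (stripIter e l v.1))) ∧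
    ∀ n l k : ℤ, |(stripIter e k (deckZ n (stripIter e l v.1))).1 -
      (deckZ n (stripIter e l v.1)).1 - k * v.2| ≤ 1}
  have hcont : ∀ n l : ℤ, Continuous fun v : StripA × ℝ => deckZ n (stripIter e l v.1) :=
    fun n l => (continuous_deckZ n).comp ((continuous_stripIter e l).comp continuous_fst)
  have hF : IsClosed F := by
    refine IsClosed.inter ?_ ?_
    · change IsClosed {v : StripA × ℝ | ∀ m k n l : ℤ,
        Comparable e (deckZ m (stripIter e k v.1)) (deckZ n (stripIter e l v.1))}
      simp only [ofPred_forall]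
      exact isClosed_iInter fun m => isClosed_iInter fun k => isClosed_iInter fun n =>
        isClosed_iInter fun l => (isClosed_comparable e).preimage ((hcont m k).prodMk (hcont n l))
    · change IsClosed {v : StripA × ℝ | ∀ n l k : ℤ,
        |(stripIter e k (deckZ n (stripIter e l v.1))).1 -
          (deckZ n (stripIter e l v.1)).1 - k * v.2| ≤ 1}
      simp only [ofPred_forall]
      refine isClosed_iInter fun n => isClosed_iInter fun l => isClosed_iInter fun k =>
        isClosed_le ?_ continuous_const
      have h2 := (continuous_stripIter e k).comp (hcont n l)
      have h3 := hcont n l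
      exact ((h2.fst.sub h3.fst).sub (continuous_const.mul continuous_snd)).abs
  let K : Set (StripA × ℝ) := ((Icc (0 : ℝ) 1) ×ˢ (univ : Set unitInterval)) ×ˢ Icc ρ₀ ρ₁
  have hK : IsCompact (K ∩ F) :=
    ((isCompact_Icc.prod isCompact_univ).prod isCompact_Icc).inter_right hF
  have hsub : Ioo ρ₀ ρ₁ ∩ range ((↑) : ℚ → ℝ) ⊆ Prod.snd '' (K ∩ F) := by
    rintro _ ⟨hr, r, rfl⟩
    obtain ⟨z, hz, hzS, hzr⟩ := he.exists_birkhoff_orbit h0 h1 hr.1 hr.2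
    exact ⟨(z, r), ⟨⟨⟨hz, mem_univ _⟩, Ioo_subset_Icc_self hr⟩,
      fun m k n l => hzS.comparable _ ⟨m, k, rfl⟩ _ ⟨n, l, rfl⟩,
      fun n l k => (he.abs_displacement_lt hzS hzr ⟨n, l, rfl⟩ k).le⟩, rfl⟩
  have hmem : ρ ∈ Prod.snd '' (K ∩ F) := by
    refine closure_minimal hsub (hK.image continuous_snd).isClosed ?_
    refine closure_minimal (Rat.denseRange_cast.open_subset_closure_inter isOpen_Ioo)
      isClosed_closure ?_
    rwa [closure_Ioo hlt.ne]
  obtain ⟨⟨z, _⟩, ⟨-, hz1, hz2⟩, rfl⟩ := hmem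
  have hS := he.isOrderedSet_orbitSet hz1
  refine ⟨closure (orbitSet e z), ⟨z, subset_closure ⟨0, 0, (deckZ_zero z).symm⟩⟩,
    isClosed_closure, hS.closure, ?_⟩
  refine hasOrderedRotation_of_abs_le (C := 1) fun w hw => ?_
  refine closure_minimal (t := {w : StripA | ∀ k, |(stripIter e k w).1 - w.1 - k * _| ≤ 1})
    ?_ ?_ hw
  · rintro _ ⟨n, l, rfl⟩ k
    exact hz2 n l k
  · simp only [ofPred_forall]
    exact isClosed_iInter fun k => isClosed_le
      (((continuous_stripIter e k).fst.sub continuous_fst).sub continuous_const).abs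
      continuous_const

end IsAreaTwist

/-- A closed ordered set of lifts projects to a well ordered invariant set. -/
theorem AnnulusHomeo.isWellOrdered_image (h : AnnulusHomeo) (he : IsAreaTwist h.lift)
    {S : Set StripA} (hc : IsClosed S) (hS : IsOrderedSet h.lift S) :
    annProj ⁻¹' (annProj '' S) = S ∧ IsWellOrdered h (annProj '' S) := by
  have hpre : annProj ⁻¹' (annProj '' S) = S := by
    refine Subset.antisymm ?_ (subset_preimage_image _ _)
    rintro w ⟨z, hz, hzw⟩
    obtain ⟨n, rfl⟩ := exists_deckZ_of_annProj_eq hzw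
    exact hS.deck n z hz
  have hmem : ∀ z, annProj z ∈ annProj '' S → z ∈ S := fun z hz => by
    rwa [← mem_preimage, hpre] at hz
  refine ⟨hpre, ?_, ?_, ?_, fun z w hz hw => he.apply_lt hS (hmem z hz) (hmem w hw)⟩
  · have hq := isOpenMap_annProj.isQuotientMap continuous_annProj annProj_surjective
    rw [← hq.isClosed_preimage, hpre]
    exact hc
  · refine Subset.antisymm ?_ ?_
    · rintro _ ⟨_, ⟨z, hz, rfl⟩, rfl⟩
      rw [← h.lift_proj, ← stripIter_one]
      exact mem_image_of_mem _ (hS.iter 1 z hz)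
    · rintro _ ⟨z, hz, rfl⟩
      refine ⟨_, mem_image_of_mem _ (hS.iter (-1) z hz), ?_⟩
      rw [← h.lift_proj, stripIter_neg_one, Homeomorph.apply_symm_apply]
  · rintro _ ⟨z, hz, rfl⟩ _ ⟨w, hw, rfl⟩ hzw
    obtain ⟨n, hn⟩ := exists_eq_add_of_coe_eq hzw
    rw [← annProj_deckZ n z,
      he.eq_of_comparable (hS.comparable _ (hS.deck n z hz) _ hw) hn.symm]

/-- **Aubry–Mather theorem.** For an area-preserving positive twist map `f` with lift `f̃`,
every `ρ ∈ [ρ_{f̃}(C₀), ρ_{f̃}(C₁)]` is the rotation number of a nonempty well ordered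
invariant closed set. -/
theorem statement1 (f : PositiveTwistMap)
    (hArea : MeasurePreserving f.toFun volume volume)
    (ρ₀ ρ₁ : ℝ) (h0 : HasRotNum0 f.toAnnulusHomeo ρ₀) (h1 : HasRotNum1 f.toAnnulusHomeo ρ₁)
    (ρ : ℝ) (hρ : ρ ∈ Set.Icc ρ₀ ρ₁) :
    ∃ X : Set Ann, X.Nonempty ∧ IsWellOrdered f.toAnnulusHomeo X ∧
      ∀ z : StripA, annProj z ∈ X → ∀ k : ℤ,
        -1 < (f.toAnnulusHomeo.liftIter k z).1 - z.1 - (k : ℝ) * ρ ∧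
          (f.toAnnulusHomeo.liftIter k z).1 - z.1 - (k : ℝ) * ρ < 1 := by
  have he := f.isAreaTwist hArea
  have hr0 : HasOrderedRotation f.lift {z | z.2 = 0} ρ₀ :=
    hasOrderedRotation_of_tendsto (by rintro ⟨x, _⟩ rfl; exact h0 x)
  have hr1 : HasOrderedRotation f.lift {z | z.2 = 1} ρ₁ :=
    hasOrderedRotation_of_tendsto (by rintro ⟨x, _⟩ rfl; exact h1 x)
  obtain ⟨S, hne, hc, hS, hSρ⟩ : ∃ S : Set StripA, S.Nonempty ∧ IsClosed S ∧
      IsOrderedSet f.lift S ∧ HasOrderedRotation f.lift S ρ := by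
    rcases (hρ.1.trans hρ.2).lt_or_eq with hlt | rfl
    · exact he.exists_isOrderedSet_of_lt hr0 hr1 hlt hρ
    · obtain rfl : ρ = ρ₀ := le_antisymm hρ.2 hρ.1
      exact ⟨{z | z.2 = 0}, ⟨((0 : ℝ), 0), rfl⟩, isClosed_eq continuous_snd continuous_const,
        he.isOrderedSet_zero, hr0⟩
  obtain ⟨hpre, hX⟩ := f.toAnnulusHomeo.isWellOrdered_image he hc hS
  refine ⟨annProj '' S, hne.image _, hX, fun z hz k => ?_⟩
  rw [← mem_preimage, hpre] at hz
  exact abs_lt.1 (he.abs_displacement_lt hS hSρ hz k)
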